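/- arXiv:1504.05151 — 2 statements merged into one kernel-verified Lean document; each statement's English description precedes it below -/
import Mathlib

section
/- Let d ≥ 2 be an integer and let Z = Σ_{i=1}^s m_i p_i be a fat point scheme on distinct points of P^3 satisfying: (1) w(Z) ≤ 3d + 1; (2) w_L(Z) ≤ d + 1 for every line L ⊂ P^3; (3) for every plane L ⊂ P^3, w_L(Z) ≤ 2d + 2, and whenever w_L(Z) = 2d + 2 the restricted scheme Z ∩ L satisfies h^1(L, I_{Z∩L}(d)) = 0. Then h^1(I_Z(d)) = 0. -/
open MvPolynomial Module

variable {K : Type*} [Field K]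

/-- The homogeneous prime ideal of a point of `ℙⁿ`: the ideal generated by the
linear forms vanishing at the point (equivalently, all homogeneous forms vanishing there). -/
noncomputable def pointIdeal {n : ℕ} (p : Projectivization K (Fin (n + 1) → K)) :
    Ideal (MvPolynomial (Fin (n + 1)) K) :=
  Ideal.span {f | ∃ c : Fin (n + 1) → K,
    (∑ i, c i * p.rep i) = 0 ∧ f = ∑ i, MvPolynomial.C (c i) * MvPolynomial.X i}

/-- The saturated ideal `I_Z = 𝔭₁^{m₁} ∩ ⋯ ∩ 𝔭_s^{m_s}` of the fat point scheme
`Z = Σ m_i p_i`.  (Points with multiplicity `0` contribute the unit ideal.) -/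
noncomputable def fatIdeal {n s : ℕ} (p : Fin s → Projectivization K (Fin (n + 1) → K))
    (m : Fin s → ℕ) : Ideal (MvPolynomial (Fin (n + 1)) K) :=
  ⨅ i, pointIdeal (p i) ^ m i

/-- `dim_K (R/I)_d`: the dimension of the degree-`d` graded piece of `R/I`,
computed as the dimension of the image of the degree-`d` forms in `R/I`. -/
noncomputable def hilbDim {n : ℕ} (I : Ideal (MvPolynomial (Fin (n + 1)) K)) (d : ℕ) : ℕ :=
  Module.finrank K (Submodule.map (Ideal.Quotient.mkₐ K I).toLinearMap
    (homogeneousSubmodule (Fin (n + 1)) K d))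

/-- `Σ_i C(n + m_i − 1, n)`, the expected degree (number of conditions) of a fat point
scheme with multiplicities `m` in `ℙⁿ`. -/
def expDeg {s : ℕ} (n : ℕ) (m : Fin s → ℕ) : ℕ := ∑ i, Nat.choose (n + m i - 1) n

/-- `h¹(I_Z(d)) = 0`, i.e. the fat point scheme imposes independent conditions on
degree-`d` forms. -/
def H1Zero {n s : ℕ} (p : Fin s → Projectivization K (Fin (n + 1) → K)) (m : Fin s → ℕ)
    (d : ℕ) : Prop :=
  hilbDim (fatIdeal p m) d = expDeg n m

/-- The regularity index of the fat point scheme `Z = Σ m_i p_i`: the least `d ≥ 0`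
with `h¹(I_Z(d)) = 0`. -/
noncomputable def regIndex {n s : ℕ} (p : Fin s → Projectivization K (Fin (n + 1) → K))
    (m : Fin s → ℕ) : ℕ :=
  sInf {d | H1Zero p m d}

/-- The set of points of `ℙⁿ` lying in the linear subspace `P(V)`. -/
def projSet {n : ℕ} (V : Submodule K (Fin (n + 1) → K)) :
    Set (Projectivization K (Fin (n + 1) → K)) :=
  {x | x.rep ∈ V}

open Classical in
/-- `w_L(Z)`: the sum of the multiplicities of the points of `Z` lying in `L`. -/
noncomputable def weightIn {n s : ℕ} (p : Fin s → Projectivization K (Fin (n + 1) → K))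
    (m : Fin s → ℕ) (L : Set (Projectivization K (Fin (n + 1) → K))) : ℕ :=
  ∑ i, if p i ∈ L then m i else 0

/-- `h¹(P(W), I_W(d)) = 0` for a fat point scheme supported on points of the linear
subspace `P(W) ⊆ ℙⁿ`, with `P(W) ≅ ℙᵏ`: for every linear identification
`e : Kᵏ⁺¹ ≃ W`, the fat point scheme obtained by transporting the points (with positive
multiplicity) to `ℙᵏ` imposes independent conditions on degree-`d` forms.  (This does not
depend on the chosen identification.) -/
def H1ZeroIn {n : ℕ} (k : ℕ) {s : ℕ} (W : Submodule K (Fin (n + 1) → K))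
    (p : Fin s → Projectivization K (Fin (n + 1) → K)) (m : Fin s → ℕ) (d : ℕ) : Prop :=
  ∀ e : (Fin (k + 1) → K) ≃ₗ[K] W,
    ∃ q : Fin s → Projectivization K (Fin (k + 1) → K),
      (∀ i, m i ≠ 0 →
        Projectivization.map (W.subtype ∘ₗ (e : (Fin (k + 1) → K) →ₗ[K] W))
          (W.injective_subtype.comp e.injective) (q i) = p i) ∧
      H1Zero q m d

open Classical in
/-- The multiplicities of the restricted scheme `Z ∩ L`: keep `m_i` for `p_i ∈ L`,
and `0` otherwise. -/
noncomputable def multIn {n s : ℕ} (V : Submodule K (Fin (n + 1) → K))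
    (p : Fin s → Projectivization K (Fin (n + 1) → K)) (m : Fin s → ℕ) : Fin s → ℕ :=
  fun i => if p i ∈ projSet V then m i else 0

section Weights

variable {W : Type*} {ι : Type*} [Fintype ι]

open Classical in
/-- The total weight of those vectors of the weighted family `(u, μ)` that lie in `S`. -/
noncomputable def wt (u : ι → W) (μ : ι → ℕ) (S : Set W) : ℕ :=
  ∑ i, if u i ∈ S then μ i else 0

variable {u : ι → W} {μ μ' : ι → ℕ} {S T : Set W}

lemma wt_mono (h : S ⊆ T) : wt u μ S ≤ wt u μ T := by
  classical
  refine Finset.sum_le_sum fun i _ => ?_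
  by_cases hi : u i ∈ S
  · simp [hi, h hi]
  · simp [hi]

lemma wt_mono_right (h : ∀ i, μ' i ≤ μ i) : wt u μ' S ≤ wt u μ S := by
  classical
  refine Finset.sum_le_sum fun i _ => ?_
  split_ifs
  · exact h i
  · rfl

lemma wt_union_add_wt_inter (u : ι → W) (μ : ι → ℕ) (S T : Set W) :
    wt u μ (S ∪ T) + wt u μ (S ∩ T) = wt u μ S + wt u μ T := by
  classical
  simp only [wt, ← Finset.sum_add_distrib]
  refine Finset.sum_congr rfl fun i _ => ?_
  by_cases hS : u i ∈ S <;> by_cases hT : u i ∈ T <;> simp [hS, hT]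

lemma wt_diff_add_wt_inter (u : ι → W) (μ : ι → ℕ) (S A : Set W) :
    wt u μ (S \ A) + wt u μ (S ∩ A) = wt u μ S := by
  have h := wt_union_add_wt_inter u μ (S \ A) (S ∩ A)
  rw [Set.sdiff_union_inter] at h
  have h0 : wt u μ (S \ A ∩ (S ∩ A)) = 0 := by
    have : S \ A ∩ (S ∩ A) = ∅ := by ext x; simp; tauto
    simp [this, wt]
  omega

lemma wt_univ (u : ι → W) (μ : ι → ℕ) : wt u μ Set.univ = ∑ i, μ i := by
  simp [wt]

lemma wt_le_sum (u : ι → W) (μ : ι → ℕ) (S : Set W) : wt u μ S ≤ ∑ i, μ i :=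
  (wt_mono S.subset_univ).trans_eq (wt_univ u μ)

lemma le_wt {i : ι} (h : u i ∈ S) : μ i ≤ wt u μ S := by
  classical
  refine le_trans ?_ (Finset.single_le_sum (fun j _ => Nat.zero_le _) (Finset.mem_univ i))
  simp [h]

lemma exists_pos_of_wt_lt (h : wt u μ S < wt u μ T) : ∃ i, 0 < μ i ∧ u i ∈ T ∧ u i ∉ S := by
  classical
  obtain ⟨i, -, hi⟩ := Finset.exists_lt_of_sum_lt h
  refine ⟨i, ?_⟩
  by_cases hS : u i ∈ S <;> by_cases hT : u i ∈ T <;> simp_all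

lemma wt_eq_sum_of_forall_mem (h : ∀ i, 0 < μ i → u i ∈ S) : wt u μ S = ∑ i, μ i := by
  classical
  refine Finset.sum_congr rfl fun i _ => ?_
  by_cases hS : u i ∈ S
  · simp [hS]
  · have : ¬ 0 < μ i := fun hi => hS (h i hi)
    simp [hS]; omega

lemma exists_pos_of_wt_pos (h : 0 < wt u μ S) : ∃ i, 0 < μ i ∧ u i ∈ S := by
  by_contra! hc
  have : wt u μ S = 0 := Finset.sum_eq_zero fun i _ => by
    by_cases hS : u i ∈ S
    · have := hc i
      simp only [hS, if_true]
      by_contra hne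
      exact this (Nat.pos_of_ne_zero hne) hS
    · simp [hS]
  omega

open Classical in
lemma wt_add_card_le (h : ∀ i, μ' i ≤ μ i) (F : Finset ι) (hF : ∀ i ∈ F, u i ∈ S ∧ μ' i < μ i) :
    wt u μ' S + F.card ≤ wt u μ S := by
  rw [Finset.card_eq_sum_ones, ← Finset.sum_ite_mem_eq F, wt, wt, ← Finset.sum_add_distrib]
  refine Finset.sum_le_sum fun i _ => ?_
  by_cases hi : i ∈ F
  · have := hF i hi
    simp only [this.1, hi, if_true]; omega
  · simp only [hi, if_false, add_zero]
    split_ifs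
    · exact h i
    · rfl

lemma wt_lt (h : ∀ i, μ' i ≤ μ i) {i : ι} (hi : u i ∈ S) (hlt : μ' i < μ i) :
    wt u μ' S + 1 ≤ wt u μ S := by
  simpa using wt_add_card_le h {i} (by simp [hi, hlt])

lemma wt_lt₂ (h : ∀ i, μ' i ≤ μ i) {i j : ι} (hij : i ≠ j) (hi : u i ∈ S) (hlt : μ' i < μ i)
    (hj : u j ∈ S) (hlt' : μ' j < μ j) :
    wt u μ' S + 2 ≤ wt u μ S := by
  classical
  simpa [hij] using wt_add_card_le (S := S) (u := u) h {i, j} (by simp [*])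

lemma wt_lt₃ (h : ∀ i, μ' i ≤ μ i) {i j l : ι} (hij : i ≠ j) (hil : i ≠ l) (hjl : j ≠ l)
    (hi : u i ∈ S) (hlt : μ' i < μ i)
    (hj : u j ∈ S) (hlt' : μ' j < μ j) (hl : u l ∈ S) (hlt'' : μ' l < μ l) :
    wt u μ' S + 3 ≤ wt u μ S := by
  classical
  simpa [hij, hil, hjl] using wt_add_card_le (S := S) (u := u) h {i, j, l} (by simp [*])

end Weights

section WtBound

/-- The weighted vectors of a three-dimensional space obey the bounds that allow them to be
covered by `e` bases and `k` pairs of independent vectors. -/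
structure WtBound (K : Type*) [Field K] {W : Type*} [AddCommGroup W] [Module K W] {ι : Type*}
    [Fintype ι] (u : ι → W) (μ : ι → ℕ) (e k : ℕ) : Prop where
  line : ∀ U : Submodule K W, finrank K U = 1 → wt u μ U ≤ e
  plane : ∀ U : Submodule K W, finrank K U = 2 → wt u μ U ≤ 2 * e + k
  total : ∑ i, μ i ≤ 3 * e + 2 * k

variable {W : Type*} [AddCommGroup W] [Module K W] {ι : Type*} [Fintype ι] {u : ι → W}
  {μ μ' : ι → ℕ} {e k : ℕ}

lemma linearIndependent_triple {a b c : W} (ha : a ≠ 0) (hb : b ∉ Submodule.span K {a})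
    (hc : c ∉ Submodule.span K {a, b}) : LinearIndependent K ![c, b, a] := by
  refine linearIndependent_finCons.2 ⟨linearIndependent_finCons.2 ⟨?_, ?_⟩, ?_⟩
  · rw [linearIndependent_unique_iff]
    simpa using ha
  · simpa using hb
  · simpa [Matrix.range_cons, Set.pair_comm] using hc

lemma span_pair_le {a b : W} {A : Submodule K W} (ha : a ∈ A) (hb : b ∈ A) :
    Submodule.span K {a, b} ≤ A := by
  rw [Submodule.span_le]; rintro x (rfl | rfl) <;> assumption

lemma finrank_span_pair_le (a b : W) : finrank K (Submodule.span K {a, b}) ≤ 2 := by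
  classical
  have := finrank_span_finset_le_card (R := K) ({a, b} : Finset W)
  rw [Finset.coe_pair] at this
  exact this.trans Finset.card_le_two

lemma finrank_span_singleton_le_one (a : W) : finrank K (Submodule.span K {a}) ≤ 1 := by
  classical
  have := finrank_span_finset_le_card (R := K) ({a} : Finset W)
  rwa [Finset.coe_singleton] at this

variable [FiniteDimensional K W]

lemma WtBound.wt_le_line (h : WtBound K u μ e k) (hu : ∀ i, u i ≠ 0) {U : Submodule K W}
    (hU : finrank K U ≤ 1) : wt u μ U ≤ e := by
  rcases Nat.le_one_iff_eq_zero_or_eq_one.1 hU with h0 | h1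
  · rw [Submodule.finrank_eq_zero] at h0
    subst h0
    by_contra! hc
    obtain ⟨i, -, hi⟩ := exists_pos_of_wt_pos (Nat.zero_lt_of_lt hc)
    exact hu i (by simpa using hi)
  · exact h.line U h1

lemma WtBound.wt_le_span (h : WtBound K u μ e k) (hu : ∀ i, u i ≠ 0) (x : W) :
    wt u μ (Submodule.span K {x} : Submodule K W) ≤ e :=
  h.wt_le_line hu (finrank_span_singleton_le_one x)

lemma WtBound.wt_inf_le (h : WtBound K u μ e k) (hu : ∀ i, u i ≠ 0) {A B : Submodule K W}
    (hA : finrank K A ≤ 2) (hAB : ¬ A ≤ B) :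
    wt u μ ((A : Set W) ∩ B) ≤ e := by
  rw [← Submodule.coe_inf]
  refine h.wt_le_line hu ?_
  have : finrank K (A ⊓ B : Submodule K W) < finrank K A :=
    Submodule.finrank_lt_finrank_of_lt (inf_lt_left.2 hAB)
  omega

lemma WtBound.le_mult (h : WtBound K u μ e k) (hu : ∀ i, u i ≠ 0) (i : ι) : μ i ≤ e :=
  (le_wt (Submodule.mem_span_singleton_self (u i))).trans (h.wt_le_span hu (u i))

lemma not_le_of_finrank_eq {A B : Submodule K W} (hAB : finrank K A = finrank K B)
    (hne : A ≠ B) : ¬ A ≤ B := fun h => hne (Submodule.eq_of_le_of_finrank_eq h hAB)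

end WtBound

section Steps
variable {W : Type*} [AddCommGroup W] [Module K W] {ι : Type*} [Fintype ι] {u : ι → W}
  {μ μ' : ι → ℕ} {e k : ℕ}
variable [FiniteDimensional K W]

/-- Either the support of the weights lies in a plane, or every plane misses some point of it. -/
lemma WtBound.exists_triple (h : WtBound K u μ e (k + 1)) (hu : ∀ i, u i ≠ 0)
    (hs : ∀ U : Submodule K W, finrank K U ≤ 2 → ∃ i, 0 < μ i ∧ u i ∉ U) :
    ∃ a b c, 0 < μ a ∧ 0 < μ b ∧ 0 < μ c ∧ LinearIndependent K ![u a, u b, u c] ∧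
      ∀ U : Submodule K W, finrank K U = 2 → wt u μ U = 2 * e + (k + 1) →
        (u a ∈ U ∧ u b ∈ U) ∨ (u a ∈ U ∧ u c ∈ U) ∨ (u b ∈ U ∧ u c ∈ U) := by
  by_cases hA : ∃ A : Submodule K W, finrank K A = 2 ∧ wt u μ A = 2 * e + (k + 1)
  swap
  · obtain ⟨a, ha, -⟩ := hs ⊥ (by simp)
    obtain ⟨b, hb, hba⟩ := hs (Submodule.span K {u a})
      ((finrank_span_singleton_le_one _).trans one_le_two)
    obtain ⟨c, hc, hcb⟩ := hs (Submodule.span K {u a, u b}) (finrank_span_pair_le _ _)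
    exact ⟨c, b, a, hc, hb, ha, linearIndependent_triple (hu a) hba hcb,
      fun U hU hU' => (hA ⟨U, hU, hU'⟩).elim⟩
  obtain ⟨A, hA2, hAw⟩ := hA
  by_cases hB : ∃ B : Submodule K W, B ≠ A ∧ finrank K B = 2 ∧ wt u μ B = 2 * e + (k + 1)
  swap
  · obtain ⟨a, ha, haA⟩ := exists_pos_of_wt_pos (u := u) (μ := μ) (S := A) (by omega)
    obtain ⟨b, hb, hbA, hba⟩ := exists_pos_of_wt_lt (u := u) (μ := μ)
      (S := (Submodule.span K {u a} : Submodule K W)) (T := A)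
      (by have := h.wt_le_span hu (u a); omega)
    obtain ⟨c, hc, hcA⟩ := hs A hA2.le
    refine ⟨c, b, a, hc, hb, ha, linearIndependent_triple (hu a) hba
      (fun hx => hcA (span_pair_le haA hbA hx)), fun U hU hU' => ?_⟩
    have : U = A := by
      by_contra hne
      exact hB ⟨U, hne, hU, hU'⟩
    subst this
    exact Or.inr (Or.inr ⟨hbA, haA⟩)
  obtain ⟨B, hBA, hB2, hBw⟩ := hB
  have hunion := wt_union_add_wt_inter u μ A B
  have hle := wt_le_sum u μ ((A : Set W) ∪ B)
  have hABe : wt u μ ((A : Set W) ∩ B) ≤ e :=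
    h.wt_inf_le hu hA2.le (not_le_of_finrank_eq (hA2.trans hB2.symm) hBA.symm)
  have htot := h.total
  have he : 0 < e := by
    obtain ⟨a, ha, -⟩ := exists_pos_of_wt_pos (u := u) (μ := μ) (S := A) (by omega)
    exact ha.trans_le (h.le_mult hu a)
  obtain ⟨o, ho, hoA, hoB⟩ := exists_pos_of_wt_pos (u := u) (μ := μ) (S := (A : Set W) ∩ B)
    (by omega)
  obtain ⟨a, ha, haA, haB⟩ := exists_pos_of_wt_lt (u := u) (μ := μ) (S := (A : Set W) ∩ B)
    (T := A) (by omega)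
  obtain ⟨b, hb, hbB, hbA⟩ := exists_pos_of_wt_lt (u := u) (μ := μ) (S := (A : Set W) ∩ B)
    (T := B) (by omega)
  replace haB : u a ∉ B := fun hx => haB ⟨haA, hx⟩
  replace hbA : u b ∉ A := fun hx => hbA ⟨hx, hbB⟩
  refine ⟨b, a, o, hb, ha, ho, linearIndependent_triple (hu o) (fun hx => haB ?_)
      (fun hx => hbA (span_pair_le hoA haA hx)), fun C hC hCw => ?_⟩
  · exact (Submodule.span_singleton_le_iff_mem _ _).2 hoB hx
  · by_cases hCA : C = A
    · subst hCA; exact Or.inr (Or.inr ⟨haA, hoA⟩)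
    by_cases hCB : C = B
    · subst hCB; exact Or.inr (Or.inl ⟨hbB, hoB⟩)
    exfalso
    have h1 := h.wt_inf_le hu hC.le (not_le_of_finrank_eq (hC.trans hA2.symm) hCA)
    have h2 := h.wt_inf_le hu hC.le (not_le_of_finrank_eq (hC.trans hB2.symm) hCB)
    have h3 := wt_union_add_wt_inter u μ C ((A : Set W) ∪ B)
    have h4 := wt_le_sum u μ ((C : Set W) ∪ ((A : Set W) ∪ B))
    rw [Set.inter_union_distrib_left] at h3
    have h5 := wt_union_add_wt_inter u μ ((C : Set W) ∩ A) ((C : Set W) ∩ B)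
    omega

lemma WtBound.exists_dual (hW : finrank K W = 3) (h : WtBound K u μ e (k + 1))
    (hu : ∀ i, u i ≠ 0) :
    ∃ b : Basis (Fin 3) K W, ∀ j, ∀ μ' : ι → ℕ, (∀ i, μ' i ≤ μ i) →
      (∀ i, b.coord j (u i) = 0 → 0 < μ i → μ' i < μ i) → WtBound K u μ' e k := by
  by_cases hs : ∀ U : Submodule K W, finrank K U ≤ 2 → ∃ i, 0 < μ i ∧ u i ∉ U
  · obtain ⟨x, y, z, hx, hy, hz, hli, ht⟩ := h.exists_triple hu hs
    have hxy : x ≠ y := fun hh => by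
      have := hli.injective.ne (show (0 : Fin 3) ≠ 1 by decide); simp [hh] at this
    have hxz : x ≠ z := fun hh => by
      have := hli.injective.ne (show (0 : Fin 3) ≠ 2 by decide); simp [hh] at this
    have hyz : y ≠ z := fun hh => by
      have := hli.injective.ne (show (1 : Fin 3) ≠ 2 by decide); simp [hh] at this
    let b := basisOfLinearIndependentOfCardEqFinrank hli (by simp [hW])
    have hb0 : b 0 = u x := by simp [b]
    have hb1 : b 1 = u y := by simp [b]
    have hb2 : b 2 = u z := by simp [b]
    refine ⟨b, fun j μ' hle hlt => ⟨fun U hU => (wt_mono_right hle).trans (h.line U hU),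
      fun U hU => ?_, ?_⟩⟩
    · have h1 := h.plane U hU
      have h2 : wt u μ' U ≤ wt u μ U := wt_mono_right hle
      by_cases hw : wt u μ U = 2 * e + (k + 1)
      swap
      · omega
      obtain ⟨i, hiU, hi0, hi⟩ : ∃ i, u i ∈ U ∧ b.coord j (u i) = 0 ∧ 0 < μ i := by
        have := ht U hU hw
        fin_cases j
        · have c1 : b.coord 0 (u y) = 0 := by rw [← hb1]; simp
          have c2 : b.coord 0 (u z) = 0 := by rw [← hb2]; simp
          rcases this with ⟨_, h'⟩ | ⟨_, h'⟩ | ⟨_, h'⟩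
          exacts [⟨y, h', c1, hy⟩, ⟨z, h', c2, hz⟩, ⟨z, h', c2, hz⟩]
        · have c1 : b.coord 1 (u x) = 0 := by rw [← hb0]; simp
          have c2 : b.coord 1 (u z) = 0 := by rw [← hb2]; simp
          rcases this with ⟨h', _⟩ | ⟨_, h'⟩ | ⟨_, h'⟩
          exacts [⟨x, h', c1, hx⟩, ⟨z, h', c2, hz⟩, ⟨z, h', c2, hz⟩]
        · have c1 : b.coord 2 (u x) = 0 := by rw [← hb0]; simp
          have c2 : b.coord 2 (u y) = 0 := by rw [← hb1]; simp
          rcases this with ⟨h', _⟩ | ⟨h', _⟩ | ⟨h', _⟩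
          exacts [⟨x, h', c1, hx⟩, ⟨x, h', c1, hx⟩, ⟨y, h', c2, hy⟩]
      have := wt_lt hle (S := (U : Set W)) hiU (hlt i hi0 hi)
      omega
    · have htot := h.total
      obtain ⟨i, i', hii, hi, hi', hp, hp'⟩ : ∃ i i', i ≠ i' ∧ b.coord j (u i) = 0 ∧
          b.coord j (u i') = 0 ∧ 0 < μ i ∧ 0 < μ i' := by
        fin_cases j
        · exact ⟨y, z, hyz, by rw [← hb1]; simp, by rw [← hb2]; simp, hy, hz⟩
        · exact ⟨x, z, hxz, by rw [← hb0]; simp, by rw [← hb2]; simp, hx, hz⟩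
        · exact ⟨x, y, hxy, by rw [← hb0]; simp, by rw [← hb1]; simp, hx, hy⟩
      have := wt_lt₂ (u := u) (S := Set.univ) hle hii trivial (hlt i hi hp) trivial (hlt i' hi' hp')
      rw [wt_univ, wt_univ] at this
      omega
  push Not at hs
  obtain ⟨A, hA2, hA⟩ := hs
  have hAw := wt_eq_sum_of_forall_mem (S := (A : Set W)) hA
  have hkey : ∀ (U : Submodule K W), finrank K U = 2 → ¬ U ≤ A → wt u μ U ≤ e := by
    intro U hU hUA
    have h1 := h.wt_inf_le hu hU.le hUA
    have h2 := wt_union_add_wt_inter u μ U A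
    have h3 := wt_le_sum u μ ((U : Set W) ∪ A)
    omega
  have hsum : ∑ i, μ i ≤ 2 * e + (k + 1) := by
    rcases Nat.lt_or_ge (finrank K A) 2 with hlt | hge
    · have := h.wt_le_line hu (U := A) (by omega)
      omega
    · rw [← hAw]; exact h.plane A (le_antisymm hA2 hge)
  have he : e = 0 → ∑ i, μ i = 0 := fun h0 =>
    Finset.sum_eq_zero fun i _ => by have := h.le_mult hu i; omega
  have hfin : ∀ μ' : ι → ℕ, (∀ i, μ' i ≤ μ i) → ∑ i, μ' i ≤ 3 * e + 2 * k := by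
    intro μ' hle
    have : ∑ i, μ' i ≤ ∑ i, μ i := Finset.sum_le_sum fun i _ => hle i
    omega
  have hgen : ∀ (U : Submodule K W), finrank K U = 2 → ∀ μ' : ι → ℕ, (∀ i, μ' i ≤ μ i) →
      U ≠ A → wt u μ' U ≤ 2 * e + k := by
    intro U hU μ' hle hne
    have h1 : wt u μ' U ≤ wt u μ U := wt_mono_right hle
    have := hkey U hU (fun hUA => hne (Submodule.eq_of_le_of_finrank_le hUA (by omega)))
    omega
  by_cases htight : 0 < e ∧ wt u μ A = 2 * e + (k + 1)
  · obtain ⟨he0, htight⟩ := htight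
    obtain ⟨x, hx, hxA⟩ := exists_pos_of_wt_pos (u := u) (μ := μ) (S := A) (by omega)
    obtain ⟨y, hy, hyA, hyx⟩ := exists_pos_of_wt_lt (u := u) (μ := μ)
      (S := (Submodule.span K {u x} : Submodule K W)) (T := A)
      (by have := h.wt_le_span hu (u x); omega)
    obtain ⟨z, hz⟩ : ∃ z, z ∉ A := by
      by_contra! hc
      have : A = ⊤ := (Submodule.eq_top_iff').2 hc
      rw [this, finrank_top] at hA2
      omega
    have hli := linearIndependent_triple (hu x) hyx (fun hh => hz (span_pair_le hxA hyA hh))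
    let b := basisOfLinearIndependentOfCardEqFinrank hli (by simp [hW])
    have hb1 : b 1 = u y := by simp [b]
    have hb2 : b 2 = u x := by simp [b]
    refine ⟨b, fun j μ' hle hlt => ⟨fun U hU => (wt_mono_right hle).trans (h.line U hU),
      fun U hU => ?_, hfin μ' hle⟩⟩
    by_cases hUA : U = A
    swap
    · exact hgen U hU μ' hle hUA
    subst hUA
    obtain ⟨i, hiU, hi0, hi⟩ : ∃ i, u i ∈ U ∧ b.coord j (u i) = 0 ∧ 0 < μ i := by
      fin_cases j
      · exact ⟨y, hyA, by rw [← hb1]; simp, hy⟩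
      · exact ⟨x, hxA, by rw [← hb2]; simp, hx⟩
      · exact ⟨y, hyA, by rw [← hb1]; simp, hy⟩
    have := wt_lt hle (S := (U : Set W)) hiU (hlt i hi0 hi)
    omega
  · refine ⟨finBasisOfFinrankEq K W hW, fun j μ' hle _ => ⟨fun U hU =>
      (wt_mono_right hle).trans (h.line U hU), fun U hU => ?_, hfin μ' hle⟩⟩
    by_cases hUA : U = A
    swap
    · exact hgen U hU μ' hle hUA
    subst hUA
    have h1 : wt u μ' U ≤ wt u μ U := wt_mono_right hle
    omega

end Steps

section Steps
variable {W : Type*} [AddCommGroup W] [Module K W] {ι : Type*} {u : ι → W}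
  {μ μ' : ι → ℕ} {e k : ℕ}

lemma linearIndepOn_triple {a b c : ι} (ha : u a ≠ 0) (hb : u b ∉ Submodule.span K {u a})
    (hc : u c ∉ Submodule.span K {u a, u b}) :
    a ≠ b ∧ a ≠ c ∧ b ≠ c ∧ LinearIndepOn K u {c, b, a} := by
  have hab : a ≠ b := by
    rintro rfl; exact hb (Submodule.mem_span_singleton_self _)
  have hac : a ≠ c := by
    rintro rfl; exact hc (Submodule.subset_span (by simp))
  have hbc : b ≠ c := by
    rintro rfl; exact hc (Submodule.subset_span (by simp))
  refine ⟨hab, hac, hbc, ?_⟩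
  rw [linearIndepOn_insert (by simp [hac.symm, hbc.symm]), linearIndepOn_insert (by simp [hab.symm])]
  refine ⟨⟨by simpa using ha, by simpa using hb⟩, by simpa [Set.image_pair, Set.pair_comm] using hc⟩

variable [Fintype ι]

/-- A basis meeting all the subspaces on which the bound is tight or nearly tight lowers it. -/
lemma WtBound.of_hit (h : WtBound K u μ (e + 1) 0)
    (hplane : ∀ U : Submodule K W, finrank K U = 2 → wt u μ U ≤ 2 * e + 1) {a b c : ι}
    (ha : 0 < μ a) (hb : 0 < μ b) (hc : 0 < μ c) (hua : u a ≠ 0)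
    (hba : u b ∉ Submodule.span K {u a}) (hcab : u c ∉ Submodule.span K {u a, u b})
    (hl : ∀ X : Submodule K W, finrank K X = 1 → wt u μ X = e + 1 → u a ∈ X ∨ u b ∈ X ∨ u c ∈ X)
    (hp : ∀ U : Submodule K W, finrank K U = 2 → wt u μ U = 2 * e + 1 →
      u a ∈ U ∨ u b ∈ U ∨ u c ∈ U) :
    ∃ F : Set ι, LinearIndepOn K u F ∧ ∀ μ' : ι → ℕ, (∀ i, μ' i ≤ μ i) →
      (∀ i ∈ F, 0 < μ i → μ' i < μ i) → WtBound K u μ' e 0 := by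
  obtain ⟨hab, hac, hbc, hli⟩ := linearIndepOn_triple hua hba hcab
  refine ⟨_, hli, fun μ' hle hlt => ?_⟩
  have la := hlt a (by simp) ha
  have lb := hlt b (by simp) hb
  have lc := hlt c (by simp) hc
  have hhit : ∀ U : Submodule K W, u a ∈ U ∨ u b ∈ U ∨ u c ∈ U → wt u μ' U + 1 ≤ wt u μ U := by
    rintro U (hU | hU | hU)
    exacts [wt_lt hle hU la, wt_lt hle hU lb, wt_lt hle hU lc]
  refine ⟨fun X hX => ?_, fun U hU => ?_, ?_⟩
  · have h1 := h.line X hX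
    have h2 : wt u μ' X ≤ wt u μ X := wt_mono_right hle
    by_cases hw : wt u μ X = e + 1
    · have := hhit X (hl X hX hw); omega
    · omega
  · have h1 := hplane U hU
    have h2 : wt u μ' U ≤ wt u μ U := wt_mono_right hle
    by_cases hw : wt u μ U = 2 * e + 1
    · have := hhit U (hp U hU hw); omega
    · omega
  · have h1 := h.total
    have := wt_lt₃ (u := u) (S := Set.univ) hle hab hac hbc trivial la trivial lb trivial lc
    rw [wt_univ, wt_univ] at this
    omega

variable [FiniteDimensional K W]

lemma wt_inter_eq_zero (hu : ∀ i, u i ≠ 0) {X Y : Submodule K W} (hX : finrank K X ≤ 1)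
    (hXY : ¬ X ≤ Y) : wt u μ ((X : Set W) ∩ Y) = 0 := by
  have : finrank K (X ⊓ Y : Submodule K W) < finrank K X :=
    Submodule.finrank_lt_finrank_of_lt (inf_lt_left.2 hXY)
  have h0 : finrank K (X ⊓ Y : Submodule K W) = 0 := by omega
  rw [Submodule.finrank_eq_zero] at h0
  by_contra hc
  obtain ⟨i, -, hi⟩ := exists_pos_of_wt_pos (Nat.pos_of_ne_zero hc)
  rw [← Submodule.coe_inf, h0] at hi
  exact hu i (by simpa using hi)

lemma exists_pair_of_wt_le (hu : ∀ i, u i ≠ 0)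
    {A : Submodule K W} (hA : wt u μ A ≤ 2 * (e + 1))
    (hs : ∀ X : Submodule K W, finrank K X ≤ 1 → ∃ i, 0 < μ i ∧ u i ∈ A ∧ u i ∉ X) :
    ∃ a b, 0 < μ a ∧ 0 < μ b ∧ u a ∈ A ∧ u b ∈ A ∧ u b ∉ Submodule.span K {u a} ∧
      ∀ X ≤ A, finrank K X = 1 → wt u μ X = e + 1 → u a ∈ X ∨ u b ∈ X := by
  by_cases hX : ∃ X ≤ A, finrank K X = 1 ∧ wt u μ X = e + 1
  swap
  · obtain ⟨a, ha, haA, -⟩ := hs ⊥ (by simp)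
    obtain ⟨b, hb, hbA, hba⟩ := hs _ (finrank_span_singleton_le_one (K := K) (u a))
    exact ⟨a, b, ha, hb, haA, hbA, hba, fun X h1 h2 h3 => (hX ⟨X, h1, h2, h3⟩).elim⟩
  obtain ⟨X, hXA, hX1, hXw⟩ := hX
  obtain ⟨a, ha, haX⟩ := exists_pos_of_wt_pos (u := u) (μ := μ) (S := X) (by omega)
  have hspan : Submodule.span K {u a} ≤ X := (Submodule.span_singleton_le_iff_mem _ _).2 haX
  by_cases hY : ∃ Y ≤ A, Y ≠ X ∧ finrank K Y = 1 ∧ wt u μ Y = e + 1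
  swap
  · obtain ⟨b, hb, hbA, hba⟩ := hs X hX1.le
    refine ⟨a, b, ha, hb, hXA haX, hbA, fun hh => hba (hspan hh), fun Z h1 h2 h3 => Or.inl ?_⟩
    have : Z = X := by
      by_contra hne
      exact hY ⟨Z, h1, hne, h2, h3⟩
    exact this ▸ haX
  obtain ⟨Y, hYA, hYX, hY1, hYw⟩ := hY
  have hYX0 := wt_inter_eq_zero (μ := μ) hu hY1.le (not_le_of_finrank_eq (hY1.trans hX1.symm) hYX)
  obtain ⟨b, hb, hbY, hbX⟩ := exists_pos_of_wt_lt (u := u) (μ := μ) (S := (Y : Set W) ∩ X)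
    (T := Y) (by omega)
  refine ⟨a, b, ha, hb, hXA haX, hYA hbY, fun hh => hbX ⟨hbY, hspan hh⟩, fun Z h1 h2 h3 => ?_⟩
  by_cases hZX : Z = X
  · exact Or.inl (hZX ▸ haX)
  by_cases hZY : Z = Y
  · exact Or.inr (hZY ▸ hbY)
  exfalso
  have e1 := wt_inter_eq_zero (μ := μ) hu h2.le (not_le_of_finrank_eq (h2.trans hX1.symm) hZX)
  have e2 := wt_inter_eq_zero (μ := μ) hu h2.le (not_le_of_finrank_eq (h2.trans hY1.symm) hZY)
  have e3 := wt_union_add_wt_inter u μ Y X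
  have e4 := wt_union_add_wt_inter u μ Z ((Y : Set W) ∪ X)
  rw [Set.inter_union_distrib_left] at e4
  have e5 := wt_union_add_wt_inter u μ ((Z : Set W) ∩ Y) ((Z : Set W) ∩ X)
  have e6 : wt u μ ((Z : Set W) ∪ (Y ∪ X)) ≤ wt u μ A :=
    wt_mono (Set.union_subset h1 (Set.union_subset hYA hXA))
  omega

lemma WtBound.exists_indep_of_subset (h : WtBound K u μ (e + 1) 0) (hu : ∀ i, u i ≠ 0)
    {A : Submodule K W} (hA2 : finrank K A ≤ 2) (hA : ∀ i, 0 < μ i → u i ∈ A) :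
    ∃ F : Set ι, LinearIndepOn K u F ∧ ∀ μ' : ι → ℕ, (∀ i, μ' i ≤ μ i) →
      (∀ i ∈ F, 0 < μ i → μ' i < μ i) → WtBound K u μ' e 0 := by
  have hAw := wt_eq_sum_of_forall_mem (S := (A : Set W)) hA
  by_cases hs : ∀ X : Submodule K W, finrank K X ≤ 1 → ∃ i, 0 < μ i ∧ u i ∉ X
  · have hA' : wt u μ A ≤ 2 * (e + 1) := by
      rcases Nat.lt_or_ge (finrank K A) 2 with hlt | hge
      · have := h.wt_le_line hu (U := A) (by omega)
        omega
      · exact h.plane A (le_antisymm hA2 hge)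
    obtain ⟨a, b, ha, hb, haA, hbA, hba, hX⟩ := exists_pair_of_wt_le hu hA' (fun X hX => by
      obtain ⟨i, hi, hiX⟩ := hs X hX
      exact ⟨i, hi, hA i hi, hiX⟩)
    have hab : a ≠ b := by
      rintro rfl; exact hba (Submodule.mem_span_singleton_self _)
    refine ⟨{b, a}, ?_, fun μ' hle hlt => ?_⟩
    · rw [linearIndepOn_insert (by simp [hab.symm])]
      exact ⟨by simpa using hu a, by simpa using hba⟩
    have la := hlt a (by simp) ha
    have lb := hlt b (by simp) hb
    have htot := wt_lt₂ (u := u) (S := Set.univ) hle hab trivial la trivial lb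
    rw [wt_univ, wt_univ] at htot
    refine ⟨fun X hX1 => ?_, fun U hU => ?_, by omega⟩
    · have h1 := h.line X hX1
      have h2 : wt u μ' X ≤ wt u μ X := wt_mono_right hle
      by_cases hw : wt u μ X = e + 1
      · have hXA : X ≤ A := by
          by_contra hXA
          have e1 := wt_inter_eq_zero (μ := μ) hu hX1.le hXA
          have e2 := wt_union_add_wt_inter u μ X A
          have e3 := wt_le_sum u μ ((X : Set W) ∪ A)
          omega
        rcases hX X hXA hX1 hw with hh | hh
        · have := wt_lt (S := (X : Set W)) hle hh la; omega
        · have := wt_lt (S := (X : Set W)) hle hh lb; omega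
      · omega
    · have := wt_le_sum u μ' U
      omega
  · push Not at hs
    obtain ⟨X, hX1, hX⟩ := hs
    have hXw := wt_eq_sum_of_forall_mem (S := (X : Set W)) hX
    have hXe := h.wt_le_line hu hX1
    by_cases h0 : ∃ a, 0 < μ a
    · obtain ⟨a, ha⟩ := h0
      refine ⟨{a}, by simpa using hu a, fun μ' hle hlt => ?_⟩
      have := wt_lt (u := u) (S := Set.univ) hle trivial (hlt a rfl ha)
      rw [wt_univ, wt_univ] at this
      refine ⟨fun U hU => ?_, fun U hU => ?_, by omega⟩
      · have := wt_le_sum u μ' U; omega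
      · have := wt_le_sum u μ' U; omega
    · push Not at h0
      refine ⟨∅, linearIndepOn_empty K u, fun μ' hle hlt => ?_⟩
      have : ∑ i, μ' i = 0 := Finset.sum_eq_zero fun i _ => by
        have := hle i; have := h0 i; omega
      refine ⟨fun U hU => ?_, fun U hU => ?_, by omega⟩
      · have := wt_le_sum u μ' U; omega
      · have := wt_le_sum u μ' U; omega

lemma WtBound.exists_indep_of_tight_plane (h : WtBound K u μ (e + 1) 0) (hu : ∀ i, u i ≠ 0)
    {A : Submodule K W} (hA2 : finrank K A = 2) (hAw : wt u μ A = 2 * (e + 1)) {c : ι}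
    (hc : 0 < μ c) (hcA : u c ∉ A) :
    ∃ F : Set ι, LinearIndepOn K u F ∧ ∀ μ' : ι → ℕ, (∀ i, μ' i ≤ μ i) →
      (∀ i ∈ F, 0 < μ i → μ' i < μ i) → WtBound K u μ' e 0 := by
  obtain ⟨a, b, ha, hb, haA, hbA, hba, hX⟩ := exists_pair_of_wt_le hu hAw.le (fun X hX => by
    obtain ⟨i, hi, hiA, hiX⟩ := exists_pos_of_wt_lt (u := u) (μ := μ) (S := X) (T := A)
      (by have := h.wt_le_line hu hX; omega)
    exact ⟨i, hi, hiA, hiX⟩)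
  obtain ⟨hab, hac, hbc, hli⟩ :=
    linearIndepOn_triple (hu a) hba (fun hh => hcA (span_pair_le haA hbA hh))
  refine ⟨_, hli, fun μ' hle hlt => ?_⟩
  have la := hlt a (by simp) ha
  have lb := hlt b (by simp) hb
  have lc := hlt c (by simp) hc
  have htot := h.total
  have hout : ∀ S : Set W, wt u μ' (S \ A) ≤ e := by
    intro S
    have h1 : wt u μ' (S \ A) ≤ wt u μ' (Set.univ \ A) :=
      wt_mono (Set.sdiff_subset_sdiff_left S.subset_univ)
    have h2 := wt_lt (u := u) (S := Set.univ \ (A : Set W)) hle ⟨trivial, hcA⟩ lc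
    have h3 := wt_diff_add_wt_inter u μ Set.univ A
    rw [Set.univ_inter, wt_univ] at h3
    omega
  have hline : ∀ X ≤ A, finrank K X ≤ 1 → wt u μ' X ≤ e := by
    intro X hXA hX1
    have h1 := h.wt_le_line hu hX1
    have h2 : wt u μ' X ≤ wt u μ X := wt_mono_right hle
    by_cases hw : wt u μ X = e + 1
    · have hX1' : finrank K X = 1 := by
        by_contra hne
        have h0 : finrank K X = 0 := by omega
        rw [Submodule.finrank_eq_zero] at h0
        obtain ⟨i, -, hi⟩ := exists_pos_of_wt_pos (u := u) (μ := μ) (S := X) (by omega)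
        rw [h0] at hi
        exact hu i (by simpa using hi)
      rcases hX X hXA hX1' hw with hh | hh
      · have := wt_lt (S := (X : Set W)) hle hh la; omega
      · have := wt_lt (S := (X : Set W)) hle hh lb; omega
    · omega
  refine ⟨fun X hX1 => ?_, fun U hU => ?_, ?_⟩
  · by_cases hXA : X ≤ A
    · exact hline X hXA hX1.le
    · have h1 := wt_inter_eq_zero (μ := μ') hu hX1.le hXA
      have h2 := wt_diff_add_wt_inter u μ' X A
      have h3 := hout X
      omega
  · by_cases hUA : U = A
    · subst hUA
      have := wt_lt₂ (u := u) (S := (U : Set W)) hle hab haA la hbA lb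
      omega
    · have h1 : finrank K (U ⊓ A : Submodule K W) < finrank K U :=
        Submodule.finrank_lt_finrank_of_lt
          (inf_lt_left.2 (not_le_of_finrank_eq (hU.trans hA2.symm) hUA))
      have h2 := hline (U ⊓ A) inf_le_right (by omega)
      rw [Submodule.coe_inf] at h2
      have h3 := wt_diff_add_wt_inter u μ' U A
      have h4 := hout U
      omega
  · have := wt_lt₃ (u := u) (S := Set.univ) hle hab hac hbc trivial la trivial lb trivial lc
    rw [wt_univ, wt_univ] at this
    omega

lemma WtBound.exists_indep_of_tight_line (h : WtBound K u μ (e + 1) 0) (hu : ∀ i, u i ≠ 0)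
    (hs : ∀ U : Submodule K W, finrank K U ≤ 2 → ∃ i, 0 < μ i ∧ u i ∉ U)
    (hplane : ∀ U : Submodule K W, finrank K U ≤ 2 → wt u μ U ≤ 2 * e + 1) (he : 0 < e)
    {X : Submodule K W} (hX1 : finrank K X = 1) (hXw : wt u μ X = e + 1) :
    ∃ F : Set ι, LinearIndepOn K u F ∧ ∀ μ' : ι → ℕ, (∀ i, μ' i ≤ μ i) →
      (∀ i ∈ F, 0 < μ i → μ' i < μ i) → WtBound K u μ' e 0 := by
  have huniq : ∀ Y : Submodule K W, finrank K Y = 1 → wt u μ Y = e + 1 → Y = X := by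
    intro Y hY1 hYw
    by_contra hne
    have h1 := wt_inter_eq_zero (μ := μ) hu hY1.le (not_le_of_finrank_eq (hY1.trans hX1.symm) hne)
    have h2 := wt_union_add_wt_inter u μ Y X
    have h3 : wt u μ ((Y : Set W) ∪ X) ≤ wt u μ (Y ⊔ X : Submodule K W) :=
      wt_mono (Set.union_subset (SetLike.coe_subset_coe.2 le_sup_left)
        (SetLike.coe_subset_coe.2 le_sup_right))
    have h4 := hplane (Y ⊔ X) ((Submodule.finrank_add_le_finrank_add_finrank Y X).trans (by omega))
    omega
  obtain ⟨a, ha, haX⟩ := exists_pos_of_wt_pos (u := u) (μ := μ) (S := X) (by omega)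
  by_cases hB : ∃ B : Submodule K W, finrank K B = 2 ∧ u a ∉ B ∧ wt u μ B = 2 * e + 1
  swap
  · obtain ⟨b, hb, hba⟩ := hs (Submodule.span K {u a})
      ((finrank_span_singleton_le_one _).trans one_le_two)
    obtain ⟨c, hc, hcb⟩ := hs (Submodule.span K {u a, u b}) (finrank_span_pair_le _ _)
    refine h.of_hit (fun U hU => hplane U hU.le) ha hb hc (hu a) hba hcb
      (fun Y hY1 hYw => Or.inl (huniq Y hY1 hYw ▸ haX)) (fun U hU hUw => Or.inl ?_)
    by_contra haU
    exact hB ⟨U, hU, haU, hUw⟩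
  obtain ⟨B, hB2, haB, hBw⟩ := hB
  obtain ⟨b, hb, hbB⟩ := exists_pos_of_wt_pos (u := u) (μ := μ) (S := B) (by omega)
  obtain ⟨c, hc, hcb⟩ := hs (Submodule.span K {u b, u a}) (finrank_span_pair_le _ _)
  refine h.of_hit (fun U hU => hplane U hU.le) hb ha hc (hu b)
    (fun hh => haB ((Submodule.span_singleton_le_iff_mem _ _).2 hbB hh)) hcb
    (fun Y hY1 hYw => Or.inr (Or.inl (huniq Y hY1 hYw ▸ haX))) (fun U hU hUw => ?_)
  by_cases haU : u a ∈ U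
  · exact Or.inr (Or.inl haU)
  by_cases hUB : U = B
  · exact Or.inl (hUB ▸ hbB)
  exfalso
  have h1 : wt u μ ((U : Set W) ∩ B) ≤ e := by
    have hlt : finrank K (U ⊓ B : Submodule K W) < finrank K U :=
      Submodule.finrank_lt_finrank_of_lt
        (inf_lt_left.2 (not_le_of_finrank_eq (hU.trans hB2.symm) hUB))
    rw [← Submodule.coe_inf]
    have h2 := h.wt_le_line hu (U := U ⊓ B) (by omega)
    by_contra! hlt'
    have h3 : finrank K (U ⊓ B : Submodule K W) = 1 := by
      by_contra hne
      have h0 : finrank K (U ⊓ B : Submodule K W) = 0 := by omega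
      rw [Submodule.finrank_eq_zero] at h0
      obtain ⟨i, -, hi⟩ := exists_pos_of_wt_pos (Nat.zero_lt_of_lt hlt')
      rw [h0] at hi
      exact hu i (by simpa using hi)
    have h4 := huniq _ h3 (by omega)
    have h5 : u a ∈ (U ⊓ B : Submodule K W) := by rw [h4]; exact haX
    exact haU h5.1
  have e1 := wt_inter_eq_zero (μ := μ) hu hX1.le (fun hh => haU (hh haX) : ¬ X ≤ U)
  have e2 := wt_inter_eq_zero (μ := μ) hu hX1.le (fun hh => haB (hh haX) : ¬ X ≤ B)
  have e3 := wt_union_add_wt_inter u μ U B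
  have e4 := wt_union_add_wt_inter u μ X ((U : Set W) ∪ B)
  rw [Set.inter_union_distrib_left] at e4
  have e5 := wt_union_add_wt_inter u μ ((X : Set W) ∩ U) ((X : Set W) ∩ B)
  have e6 := wt_le_sum u μ ((X : Set W) ∪ (U ∪ B))
  have e7 := h.total
  omega

lemma WtBound.exists_indep_of_no_tight (h : WtBound K u μ (e + 1) 0) (hu : ∀ i, u i ≠ 0)
    (hs : ∀ U : Submodule K W, finrank K U ≤ 2 → ∃ i, 0 < μ i ∧ u i ∉ U)
    (hplane : ∀ U : Submodule K W, finrank K U ≤ 2 → wt u μ U ≤ 2 * e + 1) (he : 0 < e)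
    (hline : ∀ X : Submodule K W, finrank K X ≤ 1 → wt u μ X ≤ e) :
    ∃ F : Set ι, LinearIndepOn K u F ∧ ∀ μ' : ι → ℕ, (∀ i, μ' i ≤ μ i) →
      (∀ i ∈ F, 0 < μ i → μ' i < μ i) → WtBound K u μ' e 0 := by
  have htot := h.total
  have hl : ∀ X : Submodule K W, finrank K X = 1 → wt u μ X = e + 1 → ∀ p : Prop, p :=
    fun X hX hw => absurd (hline X hX.le) (by omega)
  by_cases hA : ∃ A : Submodule K W, finrank K A = 2 ∧ wt u μ A = 2 * e + 1
  swap
  · obtain ⟨a, ha, -⟩ := hs ⊥ (by simp)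
    obtain ⟨b, hb, hba⟩ := hs (Submodule.span K {u a})
      ((finrank_span_singleton_le_one _).trans one_le_two)
    obtain ⟨c, hc, hcb⟩ := hs (Submodule.span K {u a, u b}) (finrank_span_pair_le _ _)
    exact h.of_hit (fun U hU => hplane U hU.le) ha hb hc (hu a) hba hcb
      (fun Y hY1 hYw => hl Y hY1 hYw _) (fun U hU hUw => (hA ⟨U, hU, hUw⟩).elim)
  obtain ⟨A, hA2, hAw⟩ := hA
  obtain ⟨c, hc, hcA⟩ := hs A hA2.le
  have hout := wt_diff_add_wt_inter u μ Set.univ A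
  rw [Set.univ_inter, wt_univ] at hout
  have hmiss : ∀ S : Set W, u c ∉ S → wt u μ (S \ A) ≤ e + 1 := by
    intro S hcS
    have h1 := wt_diff_add_wt_inter u μ (Set.univ \ (A : Set W)) S
    have h2 : μ c ≤ wt u μ ((Set.univ \ (A : Set W)) \ S) := le_wt ⟨⟨trivial, hcA⟩, hcS⟩
    have h3 : wt u μ (S \ A) ≤ wt u μ ((Set.univ \ (A : Set W)) ∩ S) :=
      wt_mono fun x hx => ⟨⟨trivial, hx.2⟩, hx.1⟩
    omega
  have hmeet : ∀ B : Submodule K W, wt u μ B = 2 * e + 1 → u c ∉ B →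
      e ≤ wt u μ ((B : Set W) ∩ A) := by
    intro B hBw hcB
    have h1 := hmiss B hcB
    have h2 := wt_diff_add_wt_inter u μ B A
    omega
  obtain ⟨a, ha, haA⟩ := exists_pos_of_wt_pos (u := u) (μ := μ) (S := A) (by omega)
  obtain ⟨b, hb, hbA, hba⟩ := exists_pos_of_wt_lt (u := u) (μ := μ)
    (S := (Submodule.span K {u a} : Submodule K W)) (T := A)
    (by have := hline _ (finrank_span_singleton_le_one (K := K) (u a)); omega)
  by_cases hB : ∃ B : Submodule K W, finrank K B = 2 ∧ wt u μ B = 2 * e + 1 ∧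
      u a ∉ B ∧ u b ∉ B ∧ u c ∉ B
  swap
  · refine h.of_hit (fun U hU => hplane U hU.le) ha hb hc (hu a) hba
      (fun hh => hcA (span_pair_le haA hbA hh)) (fun Y hY1 hYw => hl Y hY1 hYw _)
      (fun U hU hUw => ?_)
    by_contra! hcon
    exact hB ⟨U, hU, hUw, hcon⟩
  obtain ⟨B, hB2, hBw, haB, hbB, hcB⟩ := hB
  obtain ⟨x, hx, hxB, hxA⟩ := exists_pos_of_wt_pos (he.trans_le (hmeet B hBw hcB))
  refine h.of_hit (fun U hU => hplane U hU.le) hx ha hc (hu x)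
    (fun hh => haB ((Submodule.span_singleton_le_iff_mem _ _).2 hxB hh))
    (fun hh => hcA (span_pair_le hxA haA hh)) (fun Y hY1 hYw => hl Y hY1 hYw _)
    (fun U hU hUw => ?_)
  by_contra! hcon
  obtain ⟨hxU, haU, hcU⟩ := hcon
  have hUB : U ≠ B := fun hh => hxU (hh ▸ hxB)
  have hUA : U ≠ A := fun hh => haU (hh ▸ haA)
  have hBA : B ≠ A := fun hh => haB (hh ▸ haA)
  have dim : ∀ {C D : Submodule K W}, finrank K C = 2 → finrank K D = 2 → C ≠ D →
      wt u μ ((C : Set W) ∩ D) ≤ e := by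
    intro C D hC hD hne
    have hlt : finrank K (C ⊓ D : Submodule K W) < finrank K C :=
      Submodule.finrank_lt_finrank_of_lt
        (inf_lt_left.2 (not_le_of_finrank_eq (hC.trans hD.symm) hne))
    rw [← Submodule.coe_inf]
    exact hline _ (by omega)
  have d1 := dim hU hB2 hUB
  have d2 := dim hU hA2 hUA
  have d3 := dim hB2 hA2 hBA
  have s1 := wt_diff_add_wt_inter u μ U A
  have s2 := wt_diff_add_wt_inter u μ B A
  have s3 := wt_union_add_wt_inter u μ ((U : Set W) \ A) ((B : Set W) \ A)
  have s4 := hmiss ((U : Set W) ∪ B) (by rintro (hh | hh) <;> contradiction)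
  rw [Set.union_sdiff_distrib] at s4
  have s5 : wt u μ (((U : Set W) \ A) ∩ (B \ A)) ≤ wt u μ ((U : Set W) ∩ B) :=
    wt_mono fun x hx => ⟨hx.1.1, hx.2.1⟩
  omega

lemma WtBound.exists_indep (h : WtBound K u μ (e + 1) 0) (hu : ∀ i, u i ≠ 0) :
    ∃ F : Set ι, LinearIndepOn K u F ∧ ∀ μ' : ι → ℕ, (∀ i, μ' i ≤ μ i) →
      (∀ i ∈ F, 0 < μ i → μ' i < μ i) → WtBound K u μ' e 0 := by
  by_cases hs : ∀ U : Submodule K W, finrank K U ≤ 2 → ∃ i, 0 < μ i ∧ u i ∉ U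
  swap
  · push Not at hs
    obtain ⟨A, hA2, hA⟩ := hs
    exact h.exists_indep_of_subset hu hA2 hA
  by_cases hA : ∃ A : Submodule K W, finrank K A = 2 ∧ wt u μ A = 2 * (e + 1)
  · obtain ⟨A, hA2, hAw⟩ := hA
    obtain ⟨c, hc, hcA⟩ := hs A hA2.le
    exact h.exists_indep_of_tight_plane hu hA2 hAw hc hcA
  have hplane : ∀ U : Submodule K W, finrank K U ≤ 2 → wt u μ U ≤ 2 * e + 1 := by
    intro U hU
    rcases Nat.lt_or_ge (finrank K U) 2 with hlt | hge
    · have := h.wt_le_line hu (U := U) (by omega)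
      omega
    · have h2 : finrank K U = 2 := le_antisymm hU hge
      have h3 := h.plane U h2
      by_contra hc
      exact hA ⟨U, h2, by omega⟩
  have he : 0 < e := by
    obtain ⟨a, ha, -⟩ := hs ⊥ (by simp)
    obtain ⟨b, hb, hba⟩ := hs (Submodule.span K {u a})
      ((finrank_span_singleton_le_one _).trans one_le_two)
    have hab : a ≠ b := by
      rintro rfl; exact hba (Submodule.mem_span_singleton_self _)
    have h1 := wt_lt₂ (u := u) (μ' := fun _ => 0) (μ := μ)
      (S := (Submodule.span K {u a, u b} : Submodule K W)) (fun i => Nat.zero_le _) hab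
      (Submodule.subset_span (by simp)) ha (Submodule.subset_span (by simp)) hb
    have h2 := hplane _ (finrank_span_pair_le (u a) (u b))
    omega
  by_cases hX : ∃ X : Submodule K W, finrank K X = 1 ∧ wt u μ X = e + 1
  · obtain ⟨X, hX1, hXw⟩ := hX
    exact h.exists_indep_of_tight_line hu hs hplane he hX1 hXw
  refine h.exists_indep_of_no_tight hu hs hplane he fun X hX1 => ?_
  rcases Nat.le_one_iff_eq_zero_or_eq_one.1 hX1 with h0 | h1
  · rw [Submodule.finrank_eq_zero] at h0
    by_contra! hc
    obtain ⟨i, -, hi⟩ := exists_pos_of_wt_pos (Nat.zero_lt_of_lt hc)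
    rw [h0] at hi
    exact hu i (by simpa using hi)
  · have := h.line X h1
    by_contra hc
    exact hX ⟨X, h1, by omega⟩

end Steps

section LinearSubstitution

variable {σ τ : Type*} [Fintype σ] [Fintype τ]

/-- The linear form with coefficient vector `c`. -/
noncomputable def linForm (c : σ → K) : MvPolynomial σ K := ∑ i, C (c i) * X i

/-- The ideal generated by the linear forms vanishing at the vector `v`. -/
noncomputable def vecIdeal (v : σ → K) : Ideal (MvPolynomial σ K) :=
  Ideal.span {f | ∃ c : σ → K, (∑ i, c i * v i) = 0 ∧ f = linForm c}

lemma linForm_mem_vecIdeal {c v : σ → K} (h : c ⬝ᵥ v = 0) : linForm c ∈ vecIdeal v :=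
  Ideal.subset_span ⟨c, h, rfl⟩

lemma isHomogeneous_linForm (c : σ → K) : (linForm c).IsHomogeneous 1 :=
  IsHomogeneous.sum _ _ _ fun i _ => (isHomogeneous_X K i).C_mul (c i)

lemma linForm_single [DecidableEq σ] (i : σ) : linForm (Pi.single i (1 : K)) = X i := by
  simp [linForm, Pi.single_apply]

lemma linForm_add (a b : σ → K) : linForm (a + b) = linForm a + linForm b := by
  simp [linForm, add_mul, Finset.sum_add_distrib]

lemma linForm_smul (r : K) (b : σ → K) : linForm (r • b) = C r * linForm b := by
  simp [linForm, Finset.mul_sum, mul_assoc]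

lemma linForm_sum {ι : Type*} (s : Finset ι) (a : ι → σ → K) :
    linForm (∑ i ∈ s, a i) = ∑ i ∈ s, linForm (a i) := by
  simp only [linForm, Finset.sum_apply, map_sum, Finset.sum_mul]
  exact Finset.sum_comm

lemma coeff_linForm [DecidableEq σ] (c : σ → K) (i : σ) :
    coeff (Finsupp.single i 1) (linForm c) = c i := by
  simp [linForm, coeff_sum, coeff_C_mul, coeff_X, Finsupp.single_left_inj]

/-- Substitution of the linear forms given by the rows of a matrix for the variables. -/
noncomputable def linSubst (A : Matrix σ τ K) : MvPolynomial σ K →ₐ[K] MvPolynomial τ K :=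
  bind₁ A.toMvPolynomial

lemma linSubst_linForm (A : Matrix σ τ K) (c : σ → K) :
    linSubst A (linForm c) = linForm (Matrix.vecMul c A) := by
  simp only [linSubst, linForm, map_sum, map_mul, bind₁_X_right, algHom_C,
    Matrix.toMvPolynomial, Matrix.vecMul, dotProduct, Finset.mul_sum, Finset.sum_mul,
    ← C_mul_X_eq_monomial, algebraMap_eq]
  rw [Finset.sum_comm]
  simp [mul_assoc]

lemma linSubst_linSubst {σ υ : Type*} [Fintype υ] (A : Matrix σ τ K) (B : Matrix τ υ K)
    (f : MvPolynomial σ K) : linSubst B (linSubst A f) = linSubst (A * B) f := by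
  simp only [linSubst, bind₁_bind₁]
  congr 2
  funext i
  exact (Matrix.toMvPolynomial_mul A B i).symm

lemma linSubst_one [DecidableEq σ] (f : MvPolynomial σ K) :
    linSubst (1 : Matrix σ σ K) f = f := by
  simp [linSubst]

lemma linSubst_mem_homogeneousSubmodule {σ : Type*} (A : Matrix σ τ K) {f : MvPolynomial σ K} {d : ℕ}
    (hf : f ∈ homogeneousSubmodule σ K d) : linSubst A f ∈ homogeneousSubmodule τ K d := by
  rw [mem_homogeneousSubmodule] at hf ⊢
  have h := hf.aeval A.toMvPolynomial A.toMvPolynomial_isHomogeneous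
  rwa [one_mul] at h

lemma linSubst_mem_vecIdeal_pow (A : Matrix σ τ K) (w : τ → K) (m : ℕ) {f : MvPolynomial σ K}
    (hf : f ∈ vecIdeal (A.mulVec w) ^ m) : linSubst A f ∈ vecIdeal w ^ m := by
  have h : (vecIdeal (A.mulVec w)).map (linSubst A) ≤ vecIdeal w := by
    rw [vecIdeal, Ideal.map_span, Ideal.span_le]
    rintro _ ⟨_, ⟨c, hc, rfl⟩, rfl⟩
    change linSubst A _ ∈ _
    rw [linSubst_linForm]
    refine linForm_mem_vecIdeal ?_
    rw [← Matrix.dotProduct_mulVec]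
    exact hc
  have := Ideal.mem_map_of_mem (linSubst A) hf
  rw [Ideal.map_pow] at this
  exact Ideal.pow_right_mono h m this

lemma linSubst_mem_vecIdeal_pow_iff [DecidableEq σ] [DecidableEq τ] {A : Matrix σ τ K}
    {B : Matrix τ σ K} (hAB : A * B = 1) (hBA : B * A = 1) (w : τ → K) (m : ℕ)
    {f : MvPolynomial σ K} :
    linSubst A f ∈ vecIdeal w ^ m ↔ f ∈ vecIdeal (A.mulVec w) ^ m := by
  refine ⟨fun h => ?_, linSubst_mem_vecIdeal_pow A w m⟩
  have := linSubst_mem_vecIdeal_pow B (A.mulVec w) m (f := linSubst A f)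
    (by rwa [Matrix.mulVec_mulVec, hBA, Matrix.one_mulVec])
  rwa [linSubst_linSubst, hAB, linSubst_one] at this

lemma exists_matrix_mulVec_single [DecidableEq σ] (o : σ) {v : σ → K} (hv : v ≠ 0) :
    ∃ A B : Matrix σ σ K, A * B = 1 ∧ B * A = 1 ∧ A.mulVec (Pi.single o 1) = v := by
  have ho : (Pi.single o 1 : σ → K) ≠ 0 := by simp
  obtain ⟨g, hg⟩ := Submodule.exists_linearEquiv_restrict_eq
    ((LinearEquiv.toSpanNonzeroSingleton K _ _ ho).symm ≪≫ₗ
      LinearEquiv.toSpanNonzeroSingleton K _ _ hv)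
  refine ⟨g.toLinearMap.toMatrix', g.symm.toLinearMap.toMatrix', ?_, ?_, ?_⟩
  · rw [← LinearMap.toMatrix'_comp]; simp
  · rw [← LinearMap.toMatrix'_comp]; simp
  · rw [← Matrix.toLin'_apply, Matrix.toLin'_toMatrix']
    have := hg (LinearEquiv.toSpanNonzeroSingleton K _ _ ho 1)
    rw [LinearEquiv.trans_apply, LinearEquiv.symm_apply_apply] at this
    simpa using this.symm

end LinearSubstitution

section Order

variable {σ : Type*} [Fintype σ] [DecidableEq σ]

/-- The weight function for which the weighted order is the order of vanishing at the
`o`-th coordinate point. -/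
def offWeight (o : σ) (i : σ) : ℕ := if i = o then 0 else 1

lemma weight_offWeight (o : σ) (a : σ →₀ ℕ) :
    Finsupp.weight (offWeight o) a = ∑ i ∈ Finset.univ.erase o, a i := by
  rw [Finsupp.weight_apply, Finsupp.sum_fintype _ _ (by simp),
    ← Finset.add_sum_erase _ _ (Finset.mem_univ o)]
  simp only [offWeight, if_true, smul_zero, zero_add]
  exact Finset.sum_congr rfl fun i hi => by simp [Finset.ne_of_mem_erase hi]

lemma weightedOrder_linForm (o : σ) (c : σ → K) (hc : c o = 0) :
    1 ≤ MvPowerSeries.weightedOrder (offWeight o) (linForm c : MvPowerSeries σ K) := by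
  refine MvPowerSeries.nat_le_weightedOrder (n := 1) _ fun a ha => ?_
  rw [coeff_coe]
  by_contra h0
  have h1 := isHomogeneous_linForm c h0
  rw [weight_offWeight, Nat.lt_one_iff, Finset.sum_eq_zero_iff] at ha
  have h2 : a = Finsupp.single o 1 := by
    rw [Finsupp.weight_apply, Finsupp.sum_fintype _ _ (by simp)] at h1
    have h3 := Finset.add_sum_erase Finset.univ (fun i => a i) (Finset.mem_univ o)
    rw [Finset.sum_eq_zero ha] at h3
    simp only [Pi.one_apply, smul_eq_mul, mul_one] at h1
    ext i
    rcases eq_or_ne i o with rfl | hi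
    · simp; omega
    · simpa [Finsupp.single_apply, hi.symm] using ha i (by simp [hi])
  rw [h2, coeff_linForm] at h0
  exact h0 hc

lemma mem_vecIdeal_single_pow_iff (o : σ) (m : ℕ) (f : MvPolynomial σ K) :
    f ∈ vecIdeal (Pi.single o 1) ^ m ↔
      (m : ℕ∞) ≤ MvPowerSeries.weightedOrder (offWeight o) (f : MvPowerSeries σ K) := by
  constructor
  · intro hf
    induction m generalizing f with
    | zero => simp
    | succ m ih =>
      rw [pow_succ] at hf
      refine Submodule.mul_induction_on hf (fun g hg l hl => ?_) (fun g h hg hh => ?_)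
      · rw [coe_mul, MvPowerSeries.weightedOrder_mul, Nat.cast_succ]
        refine add_le_add (ih g hg) ?_
        refine Submodule.span_induction ?_ ?_ ?_ ?_ hl
        · rintro _ ⟨c, hc, rfl⟩
          exact weightedOrder_linForm o c (by simpa [Pi.single_apply] using hc)
        · simp
        · intro x y _ _ hx hy
          rw [coe_add]
          exact (le_min hx hy).trans (MvPowerSeries.min_weightedOrder_le_add _)
        · intro r x _ hx
          rw [smul_eq_mul, coe_mul, MvPowerSeries.weightedOrder_mul]
          exact le_add_left hx
      · rw [coe_add]
        exact (le_min hg hh).trans (MvPowerSeries.min_weightedOrder_le_add _)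
  · intro hf
    rw [f.as_sum]
    refine Ideal.sum_mem _ fun a ha => ?_
    have hm : m ≤ ∑ i ∈ Finset.univ.erase o, a i := by
      rw [← weight_offWeight]
      refine Nat.cast_le.1 (hf.trans (MvPowerSeries.weightedOrder_le _ ?_))
      rw [coeff_coe]
      exact mem_support_iff.1 ha
    rw [monomial_eq, Finsupp.prod_fintype _ _ (by simp),
      ← Finset.mul_prod_erase _ _ (Finset.mem_univ o)]
    refine Ideal.mul_mem_left _ _ (Ideal.mul_mem_left _ _ (Ideal.pow_le_pow_right hm ?_))
    rw [← Finset.prod_pow_eq_pow_sum]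
    refine Ideal.prod_mem_prod fun i hi => Ideal.pow_mem_pow ?_ _
    rw [← linForm_single (K := K)]
    exact linForm_mem_vecIdeal (by simp [Finset.ne_of_mem_erase hi])

end Order

section Vanishing

variable {σ : Type*} [Fintype σ]

lemma mem_of_linForm_mul_mem {c v : σ → K} (hcv : c ⬝ᵥ v ≠ 0) {m : ℕ} {g : MvPolynomial σ K}
    (h : linForm c * g ∈ vecIdeal v ^ m) : g ∈ vecIdeal v ^ m := by
  classical
  have hv : v ≠ 0 := by rintro rfl; simp at hcv
  obtain ⟨o, ho⟩ : ∃ o : σ, True := by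
    by_contra hc
    push Not at hc
    exact hv (funext fun i => (hc i).elim)
  obtain ⟨A, B, hAB, hBA, rfl⟩ := exists_matrix_mulVec_single o hv
  rw [← linSubst_mem_vecIdeal_pow_iff hAB hBA, mem_vecIdeal_single_pow_iff] at h ⊢
  rw [map_mul, coe_mul, MvPowerSeries.weightedOrder_mul, linSubst_linForm] at h
  have h0 : MvPowerSeries.weightedOrder (offWeight o)
      (linForm (Matrix.vecMul c A) : MvPowerSeries σ K) = 0 := by
    refine le_antisymm ((MvPowerSeries.weightedOrder_le _ (d := Finsupp.single o 1) ?_).trans ?_)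
      bot_le
    · rw [coeff_coe, coeff_linForm]
      rwa [Matrix.dotProduct_mulVec, dotProduct_single_one] at hcv
    · simp [weight_offWeight, Finset.sum_eq_zero, Finsupp.single_apply, eq_comm]
  rwa [h0, zero_add] at h

lemma mem_of_linForm_mul_mem_succ {c v : σ → K} (hc : c ≠ 0) (hv : v ≠ 0) {m : ℕ}
    {g : MvPolynomial σ K} (h : linForm c * g ∈ vecIdeal v ^ (m + 1)) : g ∈ vecIdeal v ^ m := by
  classical
  obtain ⟨o, ho⟩ : ∃ o : σ, True := by
    by_contra hc
    push Not at hc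
    exact hv (funext fun i => (hc i).elim)
  obtain ⟨A, B, hAB, hBA, rfl⟩ := exists_matrix_mulVec_single o hv
  rw [← linSubst_mem_vecIdeal_pow_iff hAB hBA, mem_vecIdeal_single_pow_iff] at h ⊢
  rw [map_mul, coe_mul, MvPowerSeries.weightedOrder_mul, linSubst_linForm] at h
  have hcA : Matrix.vecMul c A ≠ 0 := by
    intro h0
    apply hc
    rw [← Matrix.vecMul_one c, ← hAB, ← Matrix.vecMul_vecMul, h0, Matrix.zero_vecMul]
  obtain ⟨i, hi⟩ := Function.ne_iff.1 hcA
  have h1 : MvPowerSeries.weightedOrder (offWeight o)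
      (linForm (Matrix.vecMul c A) : MvPowerSeries σ K) ≤ 1 := by
    refine (MvPowerSeries.weightedOrder_le _ (d := Finsupp.single i 1) ?_).trans ?_
    · rwa [coeff_coe, coeff_linForm]
    · rw [Finsupp.weight_apply, Finsupp.sum_single_index (by simp), offWeight]
      split_ifs <;> simp
  have h2 := h.trans (add_le_add_left h1 _)
  rw [Nat.cast_succ, add_comm] at h2
  exact (ENat.add_le_add_iff_left (by simp)).1 h2

lemma homogeneousComponent_linForm_mul (c : σ → K) (d : ℕ) (g : MvPolynomial σ K) :
    homogeneousComponent (d + 1) (linForm c * g) = linForm c * homogeneousComponent d g := by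
  let _ := gradedAlgebra (σ := σ) (R := K)
  have h := DirectSum.coe_decompose_mul_of_left_mem_of_le (homogeneousSubmodule σ K) (b := g)
    (show linForm c ∈ homogeneousSubmodule σ K 1 from isHomogeneous_linForm c)
    (Nat.le_add_left 1 d)
  rw [← decomposition.decompose'_apply, ← decomposition.decompose'_apply]
  exact h

lemma homogeneousComponent_mem_vecIdeal_pow {v : σ → K} {m : ℕ} {g : MvPolynomial σ K}
    (hg : g ∈ vecIdeal v ^ m) (d : ℕ) : homogeneousComponent d g ∈ vecIdeal v ^ m := by
  let _ := gradedAlgebra (σ := σ) (R := K)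
  have h1 : (vecIdeal v).IsHomogeneous (homogeneousSubmodule σ K) := by
    refine Ideal.homogeneous_span _ _ ?_
    rintro _ ⟨c, -, rfl⟩
    exact ⟨1, isHomogeneous_linForm c⟩
  have h2 : (vecIdeal v ^ m).IsHomogeneous (homogeneousSubmodule σ K) := by
    clear hg
    induction m with
    | zero => rw [pow_zero, Ideal.one_eq_top]; exact Ideal.IsHomogeneous.top _
    | succ m ih => rw [pow_succ]; exact ih.mul h1
  exact homogeneousComponent_mem_of_mem h2 hg d

lemma sum_mul_mem_of_span {v : σ → K} {ι : Type*} [Fintype ι] {ℓ : ι → σ → K}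
    (hℓ : ∀ c : σ → K, c ⬝ᵥ v = 0 → c ∈ Submodule.span K (Set.range ℓ))
    {k d : ℕ} {f : MvPolynomial σ K} (hf : f ∈ homogeneousSubmodule σ K (d + 1))
    (hfv : f ∈ vecIdeal v ^ (k + 1)) :
    ∃ g : ι → MvPolynomial σ K, (∀ i, g i ∈ homogeneousSubmodule σ K d ∧ g i ∈ vecIdeal v ^ k) ∧
      f = ∑ i, linForm (ℓ i) * g i := by
  have key : ∃ g : ι → MvPolynomial σ K, (∀ i, g i ∈ vecIdeal v ^ k) ∧
      f = ∑ i, linForm (ℓ i) * g i := by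
    rw [pow_succ] at hfv
    refine Submodule.mul_induction_on hfv (fun g hg l hl => ?_) ?_
    · have : ∃ a : ι → MvPolynomial σ K, l = ∑ i, linForm (ℓ i) * a i := by
        refine Submodule.span_induction ?_ ?_ ?_ ?_ hl
        · rintro _ ⟨c, hc, rfl⟩
          obtain ⟨a, rfl⟩ := (Submodule.mem_span_range_iff_exists_fun K).1 (hℓ c hc)
          refine ⟨fun i => C (a i), ?_⟩
          rw [linForm_sum]
          exact Finset.sum_congr rfl fun i _ => by rw [linForm_smul, mul_comm]
        · exact ⟨0, by simp⟩
        · rintro _ _ _ _ ⟨a, rfl⟩ ⟨b, rfl⟩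
          exact ⟨a + b, by simp [mul_add, Finset.sum_add_distrib]⟩
        · rintro r _ _ ⟨a, rfl⟩
          refine ⟨fun i => r * a i, ?_⟩
          rw [smul_eq_mul, Finset.mul_sum]
          exact Finset.sum_congr rfl fun i _ => by ring
      obtain ⟨a, rfl⟩ := this
      refine ⟨fun i => a i * g, fun i => Ideal.mul_mem_left _ _ hg, ?_⟩
      rw [Finset.mul_sum]
      exact Finset.sum_congr rfl fun i _ => by ring
    · rintro _ _ ⟨a, ha, rfl⟩ ⟨b, hb, rfl⟩
      exact ⟨a + b, fun i => Ideal.add_mem _ (ha i) (hb i), by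
        simp [mul_add, Finset.sum_add_distrib]⟩
  obtain ⟨g, hg, hfg⟩ := key
  refine ⟨fun i => homogeneousComponent d (g i), fun i => ⟨homogeneousComponent_mem d _, ?_⟩, ?_⟩
  · exact homogeneousComponent_mem_vecIdeal_pow (hg i) d
  · have h1 : f = homogeneousComponent (d + 1) f := by
      rw [homogeneousComponent_of_mem hf, if_pos rfl]
    rw [h1, hfg, map_sum]
    exact Finset.sum_congr rfl fun i _ => homogeneousComponent_linForm_mul _ _ _

lemma exists_eq_linForm_mul_add {c v : σ → K} (hcv : c ⬝ᵥ v = 1) {d : ℕ}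
    {f : MvPolynomial σ K} (hf : f ∈ homogeneousSubmodule σ K (d + 1)) :
    ∃ g ∈ homogeneousSubmodule σ K d, f - linForm c * g ∈ vecIdeal v := by
  classical
  have key : ∀ f : MvPolynomial σ K, (∀ a ∈ f.support, a ≠ 0) →
      ∃ g, f - linForm c * g ∈ vecIdeal v := by
    intro f hf
    have hX : f ∈ Ideal.span (X '' (Set.univ : Set σ)) := by
      rw [mem_ideal_span_X_image]
      intro a ha
      simpa using Finsupp.ne_iff.1 (hf a ha)
    refine Submodule.span_induction ?_ ?_ ?_ ?_ hX
    · rintro _ ⟨i, -, rfl⟩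
      refine ⟨C (v i), ?_⟩
      rw [mul_comm, ← linForm_smul, ← linForm_single (K := K) i, sub_eq_add_neg,
        ← neg_one_mul, ← C_1, ← C_neg, ← linForm_smul, ← linForm_add]
      refine linForm_mem_vecIdeal ?_
      simp [add_dotProduct, hcv]
    · exact ⟨0, by simp⟩
    · rintro x y _ _ ⟨a, ha⟩ ⟨b, hb⟩
      exact ⟨a + b, by convert! Ideal.add_mem _ ha hb using 1; ring⟩
    · rintro r x _ ⟨a, ha⟩
      exact ⟨r * a, by convert! Ideal.mul_mem_left _ r ha using 1; rw [smul_eq_mul]; ring⟩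
  obtain ⟨g, hg⟩ := key f fun a ha h0 => by
    have := (mem_homogeneousSubmodule _ _).1 hf (mem_support_iff.1 ha)
    simp [h0] at this
  refine ⟨homogeneousComponent d g, homogeneousComponent_mem d g, ?_⟩
  rw [← pow_one (vecIdeal v)] at hg ⊢
  have := homogeneousComponent_mem_vecIdeal_pow hg (d + 1)
  rwa [map_sub, homogeneousComponent_linForm_mul, homogeneousComponent_of_mem hf,
    if_pos rfl] at this

end Vanishing

section AddPoint

variable {σ ι : Type*} [Fintype σ]

open Classical in
/-- The multiplicities left after dividing by a linear form with coefficient vector `c`. -/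
noncomputable def resMult (c : σ → K) (w : ι → σ → K) (μ : ι → ℕ) (i : ι) : ℕ :=
  if c ⬝ᵥ w i = 0 then μ i - 1 else μ i

lemma resMult_le (c : σ → K) (w : ι → σ → K) (μ : ι → ℕ) (i : ι) : resMult c w μ i ≤ μ i := by
  unfold resMult
  split_ifs <;> omega

lemma resMult_lt {c : σ → K} {w : ι → σ → K} {μ : ι → ℕ} {i : ι} (h : c ⬝ᵥ w i = 0)
    (hi : 0 < μ i) : resMult c w μ i < μ i := by
  rw [resMult, if_pos h]
  omega

lemma linForm_mul_mem {c : σ → K} {w : ι → σ → K} {μ : ι → ℕ} {i : ι} {h : MvPolynomial σ K}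
    (hh : h ∈ vecIdeal (w i) ^ resMult c w μ i) : linForm c * h ∈ vecIdeal (w i) ^ μ i := by
  unfold resMult at hh
  split_ifs at hh with hc
  · have := Ideal.mul_mem_mul (linForm_mem_vecIdeal hc) hh
    rw [← pow_succ'] at this
    exact Ideal.pow_le_pow_right (by omega) this
  · exact Ideal.mul_mem_left _ _ hh

lemma linForm_mul_mem_homogeneousSubmodule (c : σ → K) {h : MvPolynomial σ K} {d : ℕ}
    (hh : h ∈ homogeneousSubmodule σ K d) :
    linForm c * h ∈ homogeneousSubmodule σ K (d + 1) := by
  rw [mem_homogeneousSubmodule] at hh ⊢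
  rw [add_comm]
  exact (isHomogeneous_linForm c).mul hh

lemma exists_dotProduct_eq (φ : Dual K (σ → K)) : ∃ c : σ → K, ∀ x, c ⬝ᵥ x = φ x := by
  classical
  obtain ⟨c, rfl⟩ := (dotProductEquiv K σ).surjective φ
  exact ⟨c, fun x => rfl⟩

lemma exists_dotProduct_eq_one {v : σ → K} (hv : v ≠ 0) {w : ι → σ → K} {F : Set ι}
    (hF : LinearIndepOn K (fun i => (Submodule.span K {v}).mkQ (w i)) F) :
    ∃ c : σ → K, c ⬝ᵥ v = 1 ∧ ∀ i ∈ F, c ⬝ᵥ w i = 0 := by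
  have hvF : v ∉ Submodule.span K (w '' F) := by
    intro h
    obtain ⟨l, hl, hlv⟩ := (Finsupp.mem_span_image_iff_linearCombination K).1 h
    have h0 := linearIndepOn_iff.1 hF l hl (by
      rw [Finsupp.linearCombination_apply] at hlv ⊢
      have := congrArg (Submodule.span K {v}).mkQ hlv
      rw [map_finsuppSum] at this
      simp only [map_smul] at this
      rw [this]
      simp)
    rw [h0, map_zero] at hlv
    exact hv hlv.symm
  obtain ⟨φ, hφ, hle⟩ := Submodule.exists_le_ker_of_notMem hvF
  obtain ⟨c, hc⟩ := exists_dotProduct_eq φ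
  refine ⟨(φ v)⁻¹ • c, ?_, fun i hi => ?_⟩
  · rw [smul_dotProduct, hc, smul_eq_mul, inv_mul_cancel₀ hφ]
  · rw [smul_dotProduct, hc, show φ (w i) = 0 from hle (Submodule.subset_span ⟨i, hi, rfl⟩),
      smul_zero]

lemma mem_span_of_dotProduct_eq_zero {v : σ → K} {κ : Type*} [Fintype κ]
    (b : Basis κ K ((σ → K) ⧸ Submodule.span K {v})) {ℓ : κ → σ → K}
    (hℓ : ∀ j x, ℓ j ⬝ᵥ x = b.coord j ((Submodule.span K {v}).mkQ x)) {c : σ → K}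
    (hc : c ⬝ᵥ v = 0) : c ∈ Submodule.span K (Set.range ℓ) := by
  classical
  have hker : Submodule.span K {v} ≤ LinearMap.ker (dotProductEquiv K σ c) := by
    rw [Submodule.span_singleton_le_iff_mem]
    exact hc
  refine (Submodule.mem_span_range_iff_exists_fun K).2
    ⟨fun j => (Submodule.span K {v}).liftQ _ hker (b j), ?_⟩
  apply (dotProductEquiv K σ).injective
  ext i
  set x : σ → K := Pi.single i 1
  change (∑ j, (Submodule.span K {v}).liftQ _ hker (b j) • ℓ j) ⬝ᵥ x = c ⬝ᵥ x
  rw [sum_dotProduct]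
  have h1 : c ⬝ᵥ x = (Submodule.span K {v}).liftQ _ hker ((Submodule.span K {v}).mkQ x) := rfl
  have h2 := congrArg (fun φ : Dual K ((σ → K) ⧸ Submodule.span K {v}) =>
    φ ((Submodule.span K {v}).mkQ x)) (b.sum_dual_apply_smul_coord
      ((Submodule.span K {v}).liftQ _ hker))
  rw [h1, ← h2, LinearMap.sum_apply]
  exact Finset.sum_congr rfl fun j _ => by rw [smul_dotProduct, hℓ]; rfl

variable [Fintype ι]

lemma WtBound.exists_sub_mem (hσ : Fintype.card σ = 4) {v : σ → K} (hv : v ≠ 0)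
    {w : ι → σ → K} (hw : ∀ i, (Submodule.span K {v}).mkQ (w i) ≠ 0) (e k : ℕ) :
    ∀ μ : ι → ℕ, WtBound K (fun i => (Submodule.span K {v}).mkQ (w i)) μ e k →
      ∀ f ∈ homogeneousSubmodule σ K (e + k), f ∈ vecIdeal v ^ k →
        ∃ g ∈ homogeneousSubmodule σ K (e + k), (∀ i, g ∈ vecIdeal (w i) ^ μ i) ∧
          f - g ∈ vecIdeal v ^ (k + 1) := by
  have hQ : finrank K ((σ → K) ⧸ Submodule.span K {v}) = 3 := by
    have := (Submodule.span K {v}).finrank_quotient_add_finrank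
    rw [finrank_span_singleton hv, finrank_fintype_fun_eq_card] at this
    omega
  induction k with
  | zero =>
    induction e with
    | zero =>
      intro μ hμ f hf _
      refine ⟨f, hf, fun i => ?_, by simp⟩
      rw [Nat.le_zero.1 (hμ.le_mult hw i), pow_zero, Ideal.one_eq_top]
      trivial
    | succ e ih =>
      intro μ hμ f hf _
      obtain ⟨F, hF, hred⟩ := hμ.exists_indep hw
      obtain ⟨c, hcv, hcF⟩ := exists_dotProduct_eq_one hv hF
      obtain ⟨g, hg, hfg⟩ := exists_eq_linForm_mul_add hcv hf
      obtain ⟨h, hh, hhw, hgh⟩ := ih (resMult c w μ)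
        (hred _ (resMult_le c w μ) fun i hi => resMult_lt (hcF i hi)) g hg (by simp)
      refine ⟨linForm c * h, linForm_mul_mem_homogeneousSubmodule c hh,
        fun i => linForm_mul_mem (hhw i), ?_⟩
      rw [zero_add, pow_one] at hgh ⊢
      convert! Ideal.add_mem _ hfg (Ideal.mul_mem_left _ (linForm c) hgh) using 1
      ring
  | succ k ih =>
    intro μ hμ f hf hfv
    obtain ⟨b, hb⟩ := hμ.exists_dual hQ hw
    choose ℓ hℓ using fun j => exists_dotProduct_eq (b.coord j ∘ₗ (Submodule.span K {v}).mkQ)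
    obtain ⟨g, hg, rfl⟩ := sum_mul_mem_of_span
      (fun c hc => mem_span_of_dotProduct_eq_zero b hℓ hc) hf hfv
    have hstep : ∀ j, ∃ h ∈ homogeneousSubmodule σ K (e + k),
        (∀ i, h ∈ vecIdeal (w i) ^ resMult (ℓ j) w μ i) ∧ g j - h ∈ vecIdeal v ^ (k + 1) :=
      fun j => ih _ (hb j _ (resMult_le _ w μ) fun i hi => resMult_lt ((hℓ j _).trans hi))
        (g j) (hg j).1 (hg j).2
    choose h hh hhw hgh using hstep
    refine ⟨∑ j, linForm (ℓ j) * h j, Submodule.sum_mem _ fun j _ =>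
      linForm_mul_mem_homogeneousSubmodule _ (hh j), fun i => Ideal.sum_mem _ fun j _ =>
        linForm_mul_mem (hhw j i), ?_⟩
    rw [← Finset.sum_sub_distrib]
    refine Ideal.sum_mem _ fun j _ => ?_
    rw [← mul_sub, pow_succ']
    refine Ideal.mul_mem_mul (linForm_mem_vecIdeal ?_) (hgh j)
    rw [hℓ, LinearMap.comp_apply, Submodule.mkQ_apply,
      (Submodule.Quotient.mk_eq_zero _).2 (Submodule.mem_span_singleton_self v), map_zero]

lemma exists_sub_mem_of_wtBound (hσ : Fintype.card σ = 4) {v : σ → K} (hv : v ≠ 0)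
    {w : ι → σ → K} (hw : ∀ i, (Submodule.span K {v}).mkQ (w i) ≠ 0) {d : ℕ} {μ : ι → ℕ}
    (m : ℕ) (hm : m ≤ d + 1)
    (h : ∀ k < m, WtBound K (fun i => (Submodule.span K {v}).mkQ (w i)) μ (d - k) k)
    {f : MvPolynomial σ K} (hf : f ∈ homogeneousSubmodule σ K d) :
    ∃ g ∈ homogeneousSubmodule σ K d, (∀ i, g ∈ vecIdeal (w i) ^ μ i) ∧ f - g ∈ vecIdeal v ^ m := by
  induction m with
  | zero => exact ⟨0, Submodule.zero_mem _, fun i => Ideal.zero_mem _, by simp⟩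
  | succ m ih =>
    obtain ⟨g, hg, hgw, hfg⟩ := ih (by omega) fun k hk => h k (by omega)
    have hd : d - m + m = d := by omega
    obtain ⟨g', hg', hgw', hfg'⟩ := WtBound.exists_sub_mem hσ hv hw (d - m) m μ (h m (by omega))
      (f - g) (by rw [hd]; exact Submodule.sub_mem _ hf hg) hfg
    rw [hd] at hg'
    exact ⟨g + g', Submodule.add_mem _ hg hg', fun i => Ideal.add_mem _ (hgw i) (hgw' i), by
      rwa [← sub_sub]⟩

end AddPoint

section HilbDim

variable {n : ℕ}

instance homogeneousSubmodule_finiteDimensional (σ : Type*) [Finite σ] (d : ℕ) :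
    FiniteDimensional K (homogeneousSubmodule σ K d) :=
  Module.Finite.iff_fg.2 (homogeneousSubmodule_fg σ K d)

lemma finrank_inf_ker_add_finrank_map {V V' : Type*} [AddCommGroup V] [Module K V]
    [AddCommGroup V'] [Module K V'] (p : Submodule K V) [FiniteDimensional K p] (φ : V →ₗ[K] V') :
    finrank K (p ⊓ LinearMap.ker φ : Submodule K V) + finrank K (p.map φ) = finrank K p := by
  have h := (φ.domRestrict p).finrank_range_add_finrank_ker
  rw [LinearMap.range_domRestrict, LinearMap.ker_domRestrict] at h
  rw [← h, add_comm, ← Submodule.finrank_map_subtype_eq, Submodule.map_comap_subtype]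

lemma finrank_inf_add_hilbDim (I : Ideal (MvPolynomial (Fin (n + 1)) K)) (d : ℕ) :
    finrank K (homogeneousSubmodule (Fin (n + 1)) K d ⊓ I.restrictScalars K :
      Submodule K (MvPolynomial (Fin (n + 1)) K)) + hilbDim I d =
        finrank K (homogeneousSubmodule (Fin (n + 1)) K d) := by
  have h : I.restrictScalars K = LinearMap.ker (Ideal.Quotient.mkₐ K I).toLinearMap := by
    ext f
    simp [Ideal.Quotient.eq_zero_iff_mem]
  rw [h, hilbDim]
  exact finrank_inf_ker_add_finrank_map _ _

lemma hilbDim_top (d : ℕ) : hilbDim (⊤ : Ideal (MvPolynomial (Fin (n + 1)) K)) d = 0 := by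
  have h := finrank_inf_add_hilbDim (⊤ : Ideal (MvPolynomial (Fin (n + 1)) K)) d
  have h1 : (⊤ : Ideal (MvPolynomial (Fin (n + 1)) K)).restrictScalars K = ⊤ := rfl
  rw [h1, inf_top_eq] at h
  omega

lemma hilbDim_inf_add_finrank_sup (I J : Ideal (MvPolynomial (Fin (n + 1)) K)) (d : ℕ) :
    hilbDim (I ⊓ J) d + finrank K (homogeneousSubmodule (Fin (n + 1)) K d) =
      hilbDim I d + hilbDim J d + finrank K
        (homogeneousSubmodule (Fin (n + 1)) K d ⊓ I.restrictScalars K ⊔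
          homogeneousSubmodule (Fin (n + 1)) K d ⊓ J.restrictScalars K :
            Submodule K (MvPolynomial (Fin (n + 1)) K)) := by
  have h := Submodule.finrank_sup_add_finrank_inf_eq
    (homogeneousSubmodule (Fin (n + 1)) K d ⊓ I.restrictScalars K)
    (homogeneousSubmodule (Fin (n + 1)) K d ⊓ J.restrictScalars K)
  rw [← inf_inf_distrib_left] at h
  have h1 := finrank_inf_add_hilbDim I d
  have h2 := finrank_inf_add_hilbDim J d
  have h3 := finrank_inf_add_hilbDim (I ⊓ J) d
  have h4 : (I ⊓ J).restrictScalars K = I.restrictScalars K ⊓ J.restrictScalars K := rfl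
  rw [h4] at h3
  omega

lemma hilbDim_inf_le (I J : Ideal (MvPolynomial (Fin (n + 1)) K)) (d : ℕ) :
    hilbDim (I ⊓ J) d ≤ hilbDim I d + hilbDim J d := by
  have h := hilbDim_inf_add_finrank_sup I J d
  have h1 := Submodule.finrank_mono (sup_le (inf_le_left (b := I.restrictScalars K))
    (inf_le_left (a := homogeneousSubmodule (Fin (n + 1)) K d) (b := J.restrictScalars K)))
  omega

lemma hilbDim_inf_eq {I J : Ideal (MvPolynomial (Fin (n + 1)) K)} {d : ℕ}
    (h : ∀ f ∈ homogeneousSubmodule (Fin (n + 1)) K d,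
      ∃ g ∈ homogeneousSubmodule (Fin (n + 1)) K d, g ∈ I ∧ f - g ∈ J) :
    hilbDim (I ⊓ J) d = hilbDim I d + hilbDim J d := by
  have h1 := hilbDim_inf_add_finrank_sup I J d
  have h2 : homogeneousSubmodule (Fin (n + 1)) K d ≤
      homogeneousSubmodule (Fin (n + 1)) K d ⊓ I.restrictScalars K ⊔
        homogeneousSubmodule (Fin (n + 1)) K d ⊓ J.restrictScalars K := fun f hf => by
    obtain ⟨g, hg, hgI, hfg⟩ := h f hf
    exact Submodule.mem_sup.2 ⟨g, ⟨hg, hgI⟩, f - g, ⟨Submodule.sub_mem _ hf hg, hfg⟩, by simp⟩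
  rw [← le_antisymm h2 (sup_le inf_le_left inf_le_left)] at h1
  omega

lemma hilbDim_iInf_le {ι : Type*} (I : ι → Ideal (MvPolynomial (Fin (n + 1)) K)) (d : ℕ)
    (s : Finset ι) : hilbDim (⨅ i ∈ s, I i) d ≤ ∑ i ∈ s, hilbDim (I i) d := by
  classical
  induction s using Finset.induction with
  | empty => simp [hilbDim_top]
  | insert a s ha ih =>
    rw [Finset.iInf_insert, Finset.sum_insert ha]
    exact (hilbDim_inf_le _ _ d).trans (Nat.add_le_add_left ih _)

open Finset in
lemma hilbDim_vecIdeal_single (m d : ℕ) :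
    hilbDim (vecIdeal (Pi.single (0 : Fin (n + 1)) (1 : K)) ^ m) d =
      #{a ∈ (univ : Finset (Fin (n + 1))).finsuppAntidiag d | ∑ i ∈ univ.erase 0, a i < m} := by
  set S : Finset (Fin (n + 1) →₀ ℕ) :=
    {a ∈ (univ : Finset (Fin (n + 1))).finsuppAntidiag d | ∑ i ∈ univ.erase 0, a i < m} with hS
  have hmem : ∀ a, a ∈ S ↔ ∑ i, a i = d ∧ ∑ i ∈ univ.erase 0, a i < m := by
    intro a
    rw [hS, mem_filter, mem_finsuppAntidiag]
    simp
  let φ : MvPolynomial (Fin (n + 1)) K →ₗ[K] (S → K) := LinearMap.pi fun a => lcoeff K a.1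
  have hφ : ∀ f a, φ f a = coeff a.1 f := fun f a => rfl
  have h1 := finrank_inf_ker_add_finrank_map (homogeneousSubmodule (Fin (n + 1)) K d) φ
  have h2 := finrank_inf_add_hilbDim (vecIdeal (Pi.single (0 : Fin (n + 1)) (1 : K)) ^ m) d
  have h3 : (homogeneousSubmodule (Fin (n + 1)) K d).map φ = ⊤ := by
    rw [eq_top_iff]
    intro c _
    refine ⟨∑ a : S, monomial a.1 (c a), Submodule.sum_mem _ fun a _ => ?_, ?_⟩
    · exact isHomogeneous_monomial _ (by
        rw [Finsupp.degree_eq_sum]; exact ((hmem _).1 a.2).1)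
    · ext a
      rw [hφ, coeff_sum]
      simp only [coeff_monomial]
      rw [Finset.sum_eq_single a (fun b _ hb => if_neg fun h => hb (Subtype.ext h)) (by simp),
        if_pos rfl]
  have h4 : homogeneousSubmodule (Fin (n + 1)) K d ⊓ LinearMap.ker φ =
      homogeneousSubmodule (Fin (n + 1)) K d ⊓
        (vecIdeal (Pi.single (0 : Fin (n + 1)) (1 : K)) ^ m).restrictScalars K := by
    ext f
    refine and_congr_right fun hf => ?_
    refine Iff.trans ?_ (mem_vecIdeal_single_pow_iff 0 m f).symm
    constructor
    · intro hf0
      refine MvPowerSeries.nat_le_weightedOrder _ fun a ha => ?_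
      rw [coeff_coe]
      by_contra hne
      refine hne (congrFun (show φ f = 0 from hf0) ⟨a, (hmem a).2 ⟨?_, ?_⟩⟩)
      · rw [← Finsupp.degree_eq_sum, Finsupp.degree_eq_weight_one]; exact hf hne
      · rwa [weight_offWeight] at ha
    · intro hle
      ext a
      rw [hφ, ← coeff_coe]
      refine MvPowerSeries.coeff_eq_zero_of_lt_weightedOrder (offWeight 0) (lt_of_lt_of_le ?_ hle)
      rw [weight_offWeight]
      exact Nat.cast_lt.2 ((hmem _).1 a.2).2
  rw [h4, h3, finrank_top, finrank_fintype_fun_eq_card, Fintype.card_coe] at h1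
  omega

lemma hilbDim_vecIdeal_pow {v : Fin (n + 1) → K} (hv : v ≠ 0) (m d : ℕ) :
    hilbDim (vecIdeal v ^ m) d = hilbDim (vecIdeal (Pi.single (0 : Fin (n + 1)) (1 : K)) ^ m) d := by
  obtain ⟨A, B, hAB, hBA, rfl⟩ := exists_matrix_mulVec_single 0 hv
  have hinj : Function.Injective (linSubst A).toLinearMap :=
    Function.LeftInverse.injective (g := linSubst B) fun f => by
      simp [linSubst_linSubst, hAB, linSubst_one]
  have h1 := finrank_inf_add_hilbDim (vecIdeal (A.mulVec (Pi.single 0 1)) ^ m) d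
  have h2 := finrank_inf_add_hilbDim (vecIdeal (Pi.single (0 : Fin (n + 1)) (1 : K)) ^ m) d
  have h3 : (homogeneousSubmodule (Fin (n + 1)) K d ⊓
      (vecIdeal (A.mulVec (Pi.single 0 1)) ^ m).restrictScalars K).map (linSubst A).toLinearMap =
      homogeneousSubmodule (Fin (n + 1)) K d ⊓
        (vecIdeal (Pi.single (0 : Fin (n + 1)) (1 : K)) ^ m).restrictScalars K := by
    ext f
    constructor
    · rintro ⟨g, ⟨hg, hgm⟩, rfl⟩
      exact ⟨linSubst_mem_homogeneousSubmodule A hg,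
        (linSubst_mem_vecIdeal_pow_iff hAB hBA _ m).2 hgm⟩
    · rintro ⟨hf, hfm⟩
      have hf' : linSubst A (linSubst B f) = f := by rw [linSubst_linSubst, hBA, linSubst_one]
      refine ⟨linSubst B f, ⟨linSubst_mem_homogeneousSubmodule B hf, ?_⟩, hf'⟩
      refine (linSubst_mem_vecIdeal_pow_iff hAB hBA _ m).1 ?_
      rw [hf']
      exact hfm
  rw [← h3, ← (Submodule.equivMapOfInjective _ hinj _).finrank_eq] at h2
  omega

open Finset in
lemma card_filter_finsuppAntidiag (m d : ℕ) (hn : 0 < n) :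
    #{a ∈ (univ : Finset (Fin (n + 1))).finsuppAntidiag d | ∑ i ∈ univ.erase 0, a i < m} ≤
        (n + m - 1).choose n ∧ (m ≤ d + 1 →
      #{a ∈ (univ : Finset (Fin (n + 1))).finsuppAntidiag d | ∑ i ∈ univ.erase 0, a i < m} =
        (n + m - 1).choose n) := by
  obtain _ | m := m
  · simp [Nat.choose_eq_zero_of_lt (show n - 1 < n by omega)]
  have hcard : (n + (m + 1) - 1).choose n =
      #((univ : Finset (Fin (n + 1))).finsuppAntidiag m) := by
    rw [card_finsuppAntidiag_nat_eq_choose, card_fin, show n + 1 + m - 1 = n + m by omega,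
      show n + (m + 1) - 1 = n + m by omega, Nat.choose_symm_add]
  have hsum : ∀ (a : Fin (n + 1) →₀ ℕ) (b : ℕ),
      ∑ i ∈ univ.erase 0, a.update 0 b i = ∑ i ∈ univ.erase 0, a i := fun a b =>
    sum_congr rfl fun i hi => by simp [Function.update, ne_of_mem_erase hi]
  have htot : ∀ a : Fin (n + 1) →₀ ℕ, a 0 + ∑ i ∈ univ.erase 0, a i = ∑ i, a i := fun a =>
    add_sum_erase _ _ (mem_univ _)
  have hmaps : ∀ x y : ℕ, ∀ a : Fin (n + 1) →₀ ℕ, ∑ i, a i = x → ∑ i ∈ univ.erase 0, a i ≤ y →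
      ∑ i, (a.update 0 (y - ∑ i ∈ univ.erase 0, a i)) i = y := by
    intro x y a ha hy
    rw [← htot, hsum]
    simp only [Finsupp.coe_update, Function.update_self]
    omega
  have hinv : ∀ x y : ℕ, ∀ a : Fin (n + 1) →₀ ℕ, ∑ i, a i = x →
      (a.update 0 (y - ∑ i ∈ univ.erase 0, a i)).update 0
        (x - ∑ i ∈ univ.erase 0, a.update 0 (y - ∑ i ∈ univ.erase 0, a i) i) = a := by
    intro x y a ha
    rw [hsum]
    have := htot a
    ext i
    rcases eq_or_ne i 0 with rfl | hi
    · simp only [Finsupp.coe_update, Function.update_self]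
      omega
    · simp [Function.update, hi]
  rw [hcard]
  have hle : #{a ∈ (univ : Finset (Fin (n + 1))).finsuppAntidiag d |
      ∑ i ∈ univ.erase 0, a i < m + 1} ≤ #((univ : Finset (Fin (n + 1))).finsuppAntidiag m) := by
    refine card_le_card_of_injOn (fun a => a.update 0 (m - ∑ i ∈ univ.erase 0, a i)) ?_ ?_
    · intro a ha
      simp only [coe_filter, mem_finsuppAntidiag, Set.mem_ofPred_eq, subset_univ, and_true] at ha
      simp only [mem_coe, mem_finsuppAntidiag, subset_univ, and_true]
      exact hmaps d m a ha.1 (by omega)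
    · intro a ha b hb hab
      simp only [coe_filter, mem_finsuppAntidiag, Set.mem_ofPred_eq, subset_univ, and_true] at ha hb
      dsimp only at hab
      rw [← hinv d m a ha.1, ← hinv d m b hb.1, hab]
  refine ⟨hle, fun hmd => le_antisymm hle ?_⟩
  refine card_le_card_of_injOn (fun a => a.update 0 (d - ∑ i ∈ univ.erase 0, a i)) ?_ ?_
  · intro a ha
    simp only [mem_coe, mem_finsuppAntidiag, subset_univ, and_true] at ha
    simp only [coe_filter, mem_finsuppAntidiag, Set.mem_ofPred_eq, subset_univ, and_true]
    have := (htot a).trans ha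
    exact ⟨hmaps m d a ha (by omega), by rw [hsum]; omega⟩
  · intro a ha b hb hab
    simp only [mem_coe, mem_finsuppAntidiag, subset_univ, and_true] at ha hb
    dsimp only at hab
    rw [← hinv m d a ha, ← hinv m d b hb, hab]

lemma hilbDim_vecIdeal_pow_le (hn : 0 < n) {v : Fin (n + 1) → K} (hv : v ≠ 0) (m d : ℕ) :
    hilbDim (vecIdeal v ^ m) d ≤ (n + m - 1).choose n := by
  rw [hilbDim_vecIdeal_pow hv, hilbDim_vecIdeal_single]
  exact (card_filter_finsuppAntidiag m d hn).1

lemma hilbDim_vecIdeal_pow_eq (hn : 0 < n) {v : Fin (n + 1) → K} (hv : v ≠ 0) {m d : ℕ}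
    (hm : m ≤ d + 1) : hilbDim (vecIdeal v ^ m) d = (n + m - 1).choose n := by
  rw [hilbDim_vecIdeal_pow hv, hilbDim_vecIdeal_single]
  exact (card_filter_finsuppAntidiag m d hn).2 hm

end HilbDim

section Strict

lemma wt_subtype_ne_add {W ι : Type*} [Fintype ι] [DecidableEq ι] {u : ι → W} {S : Set W} {j : ι}
    (μ : ι → ℕ) (hj : u j ∈ S) :
    wt (fun i : {i // i ≠ j} => u i) (fun i => μ i) S + μ j = wt u μ S := by
  classical
  rw [wt, wt, Fintype.sum_eq_add_sum_subtype_ne _ j, if_pos hj, add_comm]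

lemma finrank_comap_mkQ {W : Type*} [AddCommGroup W] [Module K W] [FiniteDimensional K W]
    {v : W} (hv : v ≠ 0) (U : Submodule K (W ⧸ Submodule.span K {v})) :
    finrank K (U.comap (Submodule.span K {v}).mkQ) = finrank K U + 1 := by
  have h := finrank_inf_ker_add_finrank_map (U.comap (Submodule.span K {v}).mkQ)
    (Submodule.span K {v}).mkQ
  rw [Submodule.map_comap_eq_of_surjective (Submodule.mkQ_surjective _),
    inf_of_le_right (LinearMap.ker_le_comap _), Submodule.ker_mkQ, finrank_span_singleton hv] at h
  omega

variable {ι : Type*} [Fintype ι] {r : ι → Fin 4 → K} {m : ι → ℕ} {d : ℕ}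

lemma mult_le_of_line_le (hr0 : ∀ i, r i ≠ 0)
    (h2 : ∀ V : Submodule K (Fin 4 → K), finrank K V = 2 → wt r m V ≤ d + 1) (j : ι) :
    m j ≤ d + 1 := by
  have hQ := (Submodule.span K {r j}).finrank_quotient_add_finrank
  rw [finrank_span_singleton (hr0 j), finrank_fin_fun] at hQ
  have : Nontrivial ((Fin 4 → K) ⧸ Submodule.span K {r j}) :=
    nontrivial_of_finrank_pos (R := K) (by omega)
  obtain ⟨y, hy⟩ := exists_ne (0 : (Fin 4 → K) ⧸ Submodule.span K {r j})
  refine le_trans (le_wt (u := r) ?_) (h2 ((Submodule.span K {y}).comap (Submodule.mkQ _))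
    (by rw [finrank_comap_mkQ (hr0 j), finrank_span_singleton hy]))
  simp [(Submodule.Quotient.mk_eq_zero _).2 (Submodule.mem_span_singleton_self (r j))]

lemma wtBound_quotient [DecidableEq ι] (hr0 : ∀ i, r i ≠ 0) (h1 : ∑ i, m i ≤ 3 * d + 1)
    (h2 : ∀ V : Submodule K (Fin 4 → K), finrank K V = 2 → wt r m V ≤ d + 1)
    (h3 : ∀ V : Submodule K (Fin 4 → K), finrank K V = 3 → wt r m V ≤ 2 * d + 1)
    (j : ι) {k : ℕ} (hk : k < m j) :
    WtBound K (fun i : {i // i ≠ j} => (Submodule.span K {r j}).mkQ (r i)) (fun i => m i)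
      (d - k) k := by
  have hd := mult_le_of_line_le hr0 h2 j
  have key : ∀ U : Submodule K ((Fin 4 → K) ⧸ Submodule.span K {r j}),
      wt (fun i : {i // i ≠ j} => (Submodule.span K {r j}).mkQ (r i)) (fun i => m i) U + m j =
        wt r m (U.comap (Submodule.span K {r j}).mkQ) := fun U =>
    wt_subtype_ne_add (u := fun i => (Submodule.span K {r j}).mkQ (r i)) m (by
      simp [(Submodule.Quotient.mk_eq_zero _).2 (Submodule.mem_span_singleton_self (r j))])
  refine ⟨fun U hU => ?_, fun U hU => ?_, ?_⟩
  · have := h2 _ ((finrank_comap_mkQ (hr0 j) U).trans (by rw [hU]))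
    have := key U
    omega
  · have := h3 _ ((finrank_comap_mkQ (hr0 j) U).trans (by rw [hU]))
    have := key U
    omega
  · rw [Fintype.sum_eq_add_sum_subtype_ne _ j] at h1
    omega

lemma hilbDim_iInf_vecIdeal_eq_of_plane_lt (hr0 : ∀ i, r i ≠ 0)
    (hr : ∀ i j, i ≠ j → r i ∉ Submodule.span K {r j}) (h1 : ∑ i, m i ≤ 3 * d + 1)
    (h2 : ∀ V : Submodule K (Fin 4 → K), finrank K V = 2 → wt r m V ≤ d + 1)
    (h3 : ∀ V : Submodule K (Fin 4 → K), finrank K V = 3 → wt r m V ≤ 2 * d + 1) :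
    hilbDim (⨅ i, vecIdeal (r i) ^ m i) d = ∑ i, (3 + m i - 1).choose 3 := by
  classical
  suffices h : ∀ T : Finset ι,
      hilbDim (⨅ i ∈ T, vecIdeal (r i) ^ m i) d = ∑ i ∈ T, (3 + m i - 1).choose 3 by
    simpa using h Finset.univ
  intro T
  induction T using Finset.induction with
  | empty => simp [hilbDim_top]
  | insert j T hj ih =>
    rw [Finset.iInf_insert, Finset.sum_insert hj, inf_comm, hilbDim_inf_eq, ih,
      hilbDim_vecIdeal_pow_eq (by omega) (hr0 j) (mult_le_of_line_le hr0 h2 j),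
      Nat.add_comm (∑ i ∈ T, _)]
    intro f hf
    obtain ⟨g, hg, hgw, hfg⟩ := exists_sub_mem_of_wtBound (by simp) (hr0 j)
      (fun i : {i // i ≠ j} => fun h0 => hr i j i.2 ((Submodule.Quotient.mk_eq_zero _).1 h0))
      (m j) (mult_le_of_line_le hr0 h2 j) (fun k hk => wtBound_quotient hr0 h1 h2 h3 j hk) hf
    refine ⟨g, hg, ?_, hfg⟩
    simp only [Submodule.mem_iInf]
    exact fun i hi => hgw ⟨i, fun h => hj (h ▸ hi)⟩

end Strict

section Residual

lemma exists_le_finrank_eq_of_le {W : Type*} [AddCommGroup W] [Module K W] [FiniteDimensional K W]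
    (A : Submodule K W) {n : ℕ} (hA : finrank K A ≤ n) (hn : n ≤ finrank K W) :
    ∃ B, A ≤ B ∧ finrank K B = n := by
  induction n, hA using Nat.le_induction with
  | base => exact ⟨A, le_rfl, rfl⟩
  | succ n _ ih =>
    obtain ⟨B, hAB, hB⟩ := ih (by omega)
    obtain ⟨x, -, hx⟩ := SetLike.exists_of_lt (lt_top_iff_ne_top.2 fun h : B = ⊤ => by
      rw [h, finrank_top] at hB
      omega)
    refine ⟨B ⊔ Submodule.span K {x}, hAB.trans le_sup_left, ?_⟩
    have h := Submodule.finrank_sup_add_finrank_inf_eq B (Submodule.span K {x})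
    have hx0 : x ≠ 0 := fun h => hx (h ▸ B.zero_mem)
    rw [disjoint_iff.1 ((Submodule.disjoint_span_singleton' hx0).2 hx), finrank_bot,
      finrank_span_singleton hx0] at h
    omega

variable {ι : Type*} [Fintype ι] {r : ι → Fin 4 → K} {m m' : ι → ℕ} {d : ℕ}
  {V : Submodule K (Fin 4 → K)}

lemma residual_bounds (h1 : ∑ i, m i ≤ 3 * (d + 1) + 1)
    (h2 : ∀ A : Submodule K (Fin 4 → K), finrank K A = 2 → wt r m A ≤ d + 2)
    (hV : finrank K V = 3) (hVm : wt r m V = 2 * d + 4) (hm : ∀ i, m' i ≤ m i)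
    (hlt : ∀ i, r i ∈ V → 0 < m i → m' i < m i) :
    ∑ i, m' i ≤ 3 * d + 1 ∧
      (∀ A : Submodule K (Fin 4 → K), finrank K A = 2 → wt r m' A ≤ d + 1) ∧
      ∀ A : Submodule K (Fin 4 → K), finrank K A = 3 → wt r m' A ≤ 2 * d + 1 := by
  have h2' : ∀ A : Submodule K (Fin 4 → K), finrank K A ≤ 2 → wt r m A ≤ d + 2 := by
    intro A hA
    obtain ⟨B, hAB, hB⟩ := exists_le_finrank_eq_of_le A hA (by simp)
    exact (wt_mono hAB).trans (h2 B hB)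
  have hout : ∀ S : Set (Fin 4 → K), wt r m (S \ V) ≤ d := by
    intro S
    have := wt_diff_add_wt_inter r m Set.univ V
    rw [wt_univ, Set.univ_inter] at this
    have := wt_mono (u := r) (μ := m) (Set.sdiff_subset_sdiff_left (Set.subset_univ S) (t := V))
    omega
  have key : ∀ A : Submodule K (Fin 4 → K), finrank K A ≤ 2 → wt r m' A ≤ d + 1 := by
    intro A hA
    have hA2 := h2' A hA
    have hsplit := wt_diff_add_wt_inter r m A V
    have := hout A
    rcases Nat.eq_zero_or_pos (wt r m (A ∩ V)) with h0 | hpos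
    · have := wt_mono_right (u := r) (S := A) hm
      omega
    · obtain ⟨i, hi, hiA, hiV⟩ := exists_pos_of_wt_pos hpos
      have := wt_lt (u := r) hm hiA (hlt i hiV hi)
      omega
  have hex : ∀ A : Submodule K (Fin 4 → K), finrank K A ≤ 2 → ∃ i, 0 < m i ∧ r i ∈ V ∧ r i ∉ A :=
    fun A hA => exists_pos_of_wt_lt ((h2' A hA).trans_lt (by omega))
  obtain ⟨i, hi, hiV, -⟩ := hex ⊥ (by simp)
  obtain ⟨j, hj, hjV, hji⟩ := hex (Submodule.span K {r i})
    ((finrank_span_singleton_le_one _).trans (by omega))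
  obtain ⟨l, hl, hlV, hlij⟩ := hex (Submodule.span K {r i, r j}) (finrank_span_pair_le _ _)
  have hij : i ≠ j := fun h => hji (h ▸ Submodule.mem_span_singleton_self _)
  have hil : i ≠ l := fun h => hlij (h ▸ Submodule.subset_span (by simp))
  have hjl : j ≠ l := fun h => hlij (h ▸ Submodule.subset_span (by simp))
  have h3 : ∀ S : Set (Fin 4 → K), (V : Set (Fin 4 → K)) ⊆ S → wt r m' S + 3 ≤ wt r m S :=
    fun S hS => wt_lt₃ hm hij hil hjl (hS hiV) (hlt i hiV hi) (hS hjV) (hlt j hjV hj)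
      (hS hlV) (hlt l hlV hl)
  refine ⟨?_, fun A hA => key A hA.le, fun A hA => ?_⟩
  · have := h3 _ (Set.subset_univ _)
    rw [wt_univ, wt_univ] at this
    omega
  · rcases eq_or_ne A V with rfl | hne
    · have := h3 A subset_rfl
      omega
    · have hlt : finrank K (A ⊓ V : Submodule K (Fin 4 → K)) < 3 := by
        rw [← hV]
        refine Submodule.finrank_lt_finrank_of_lt (inf_le_right.lt_of_ne fun h => hne ?_)
        exact (Submodule.eq_of_le_of_finrank_eq (inf_eq_right.1 h) (hV.trans hA.symm)).symm
      have h4 := key (A ⊓ V) (by omega)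
      rw [Submodule.coe_inf] at h4
      have := wt_diff_add_wt_inter r m' A V
      have := wt_mono_right (u := r) (S := (A : Set (Fin 4 → K)) \ V) hm
      have := hout A
      omega

end Residual

section Castelnuovo

variable {n k : ℕ}

lemma hilbDim_add_le {I I' : Ideal (MvPolynomial (Fin (n + 1)) K)}
    {J : Ideal (MvPolynomial (Fin (k + 1)) K)} {E : Matrix (Fin (n + 1)) (Fin (k + 1)) K}
    {B : Matrix (Fin (k + 1)) (Fin (n + 1)) K} (hBE : B * E = 1) {c : Fin (n + 1) → K}
    (hc : Matrix.vecMul c E = 0) (hI : ∀ g, linForm c * g ∈ I → g ∈ I')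
    (hJ : ∀ f ∈ I, linSubst E f ∈ J) (d : ℕ) :
    hilbDim I' d + hilbDim J (d + 1) ≤ hilbDim I (d + 1) := by
  let ψ : (MvPolynomial (Fin (n + 1)) K ⧸ I) →ₗ[K] (MvPolynomial (Fin (k + 1)) K ⧸ J) :=
    (Ideal.Quotient.liftₐ I ((Ideal.Quotient.mkₐ K J).comp (linSubst E)) fun f hf =>
      Ideal.Quotient.eq_zero_iff_mem.2 (hJ f hf)).toLinearMap
  have hψ : ∀ f, ψ (Ideal.Quotient.mk I f) = Ideal.Quotient.mk J (linSubst E f) := fun f => rfl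
  let μ : MvPolynomial (Fin (n + 1)) K →ₗ[K] (MvPolynomial (Fin (n + 1)) K ⧸ I) :=
    (Ideal.Quotient.mkₐ K I).toLinearMap ∘ₗ LinearMap.mulLeft K (linForm c)
  have h1 := finrank_inf_ker_add_finrank_map ((homogeneousSubmodule (Fin (n + 1)) K (d + 1)).map
    (Ideal.Quotient.mkₐ K I).toLinearMap) ψ
  have h2 : ((homogeneousSubmodule (Fin (n + 1)) K (d + 1)).map
      (Ideal.Quotient.mkₐ K I).toLinearMap).map ψ =
      (homogeneousSubmodule (Fin (k + 1)) K (d + 1)).map (Ideal.Quotient.mkₐ K J).toLinearMap := by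
    apply le_antisymm
    · rintro _ ⟨_, ⟨f, hf, rfl⟩, rfl⟩
      exact ⟨linSubst E f, linSubst_mem_homogeneousSubmodule E hf, (hψ f).symm⟩
    · rintro _ ⟨f, hf, rfl⟩
      refine ⟨_, ⟨linSubst B f, linSubst_mem_homogeneousSubmodule B hf, rfl⟩, ?_⟩
      refine (hψ _).trans ?_
      rw [linSubst_linSubst, hBE, linSubst_one]
      rfl
  have h3 := finrank_inf_ker_add_finrank_map (homogeneousSubmodule (Fin (n + 1)) K d) μ
  have h4 := finrank_inf_add_hilbDim I' d
  have h5 : homogeneousSubmodule (Fin (n + 1)) K d ⊓ LinearMap.ker μ ≤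
      homogeneousSubmodule (Fin (n + 1)) K d ⊓ I'.restrictScalars K :=
    inf_le_inf_left _ fun g hg => hI g (Ideal.Quotient.eq_zero_iff_mem.1 hg)
  have h6 : (homogeneousSubmodule (Fin (n + 1)) K d).map μ ≤
      (homogeneousSubmodule (Fin (n + 1)) K (d + 1)).map (Ideal.Quotient.mkₐ K I).toLinearMap ⊓
        LinearMap.ker ψ := by
    rintro _ ⟨g, hg, rfl⟩
    refine ⟨⟨_, linForm_mul_mem_homogeneousSubmodule c hg, rfl⟩, (hψ (linForm c * g)).trans ?_⟩
    rw [map_mul, linSubst_linForm, hc]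
    simp [linForm]
  have h7 := Submodule.finrank_mono h5
  have h8 := Submodule.finrank_mono h6
  rw [h2] at h1
  unfold hilbDim at h4 ⊢
  omega

lemma vecIdeal_smul {σ : Type*} [Fintype σ] (a : Kˣ) (v : σ → K) :
    vecIdeal (a • v) = vecIdeal v := by
  unfold vecIdeal
  congr 1
  ext f
  have h : ∀ c : σ → K, ∑ i, c i * (a • v) i = 0 ↔ ∑ i, c i * v i = 0 := fun c => by
    change c ⬝ᵥ (a : K) • v = 0 ↔ c ⬝ᵥ v = 0
    rw [dotProduct_smul, smul_eq_zero, or_iff_right a.ne_zero]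
  simp only [Set.mem_ofPred_eq, h]

lemma linSubst_mem_of_map_eq {f : (Fin (k + 1) → K) →ₗ[K] (Fin (n + 1) → K)}
    (hf : Function.Injective f) {p : Projectivization K (Fin (n + 1) → K)}
    {q : Projectivization K (Fin (k + 1) → K)} (hpq : Projectivization.map f hf q = p) (m : ℕ)
    {g : MvPolynomial (Fin (n + 1)) K} (hg : g ∈ pointIdeal p ^ m) :
    linSubst (LinearMap.toMatrix' f) g ∈ pointIdeal q ^ m := by
  refine linSubst_mem_vecIdeal_pow _ _ m ?_
  rw [LinearMap.toMatrix'_mulVec]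
  have hq : f q.rep ≠ 0 := fun h => q.rep_nonzero (hf (h.trans f.map_zero.symm))
  have hp : p = Projectivization.mk K (f q.rep) hq := by
    rw [← hpq]
    conv_lhs => rw [← q.mk_rep]
    exact Projectivization.map_mk ..
  obtain ⟨a, ha⟩ := Projectivization.exists_smul_eq_mk_rep K (f q.rep) hq
  change g ∈ vecIdeal p.rep ^ m at hg
  rwa [hp, ← ha, vecIdeal_smul] at hg

lemma exists_mem_iff_dotProduct_eq_zero {V : Submodule K (Fin (n + 1) → K)}
    (hV : finrank K V = n) : ∃ c : Fin (n + 1) → K, c ≠ 0 ∧ ∀ x, x ∈ V ↔ c ⬝ᵥ x = 0 := by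
  obtain ⟨x, -, hx⟩ := SetLike.exists_of_lt (lt_top_iff_ne_top.2 fun h : V = ⊤ => by
    rw [h, finrank_top, finrank_fin_fun] at hV
    omega)
  obtain ⟨φ, hφ, hle⟩ := Submodule.exists_le_ker_of_notMem hx
  obtain ⟨c, hc⟩ := exists_dotProduct_eq φ
  have hker : V = LinearMap.ker φ := by
    refine Submodule.eq_of_le_of_finrank_le hle ?_
    have h : finrank K (LinearMap.ker φ) < finrank K (Fin (n + 1) → K) :=
      Submodule.finrank_lt (fun h => hφ (by
        rw [LinearMap.ker_eq_top.1 h, LinearMap.zero_apply]))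
    rw [finrank_fin_fun] at h
    omega
  refine ⟨c, fun h => hφ (by rw [← hc, h, zero_dotProduct]), fun y => ?_⟩
  rw [hc, hker, LinearMap.mem_ker]

lemma resMult_mem_of_linForm_mul_mem {σ ι : Type*} [Fintype σ] {c : σ → K} (hc : c ≠ 0)
    {w : ι → σ → K} {μ : ι → ℕ} {i : ι} (hw : w i ≠ 0) {g : MvPolynomial σ K}
    (hg : linForm c * g ∈ vecIdeal (w i) ^ μ i) : g ∈ vecIdeal (w i) ^ resMult c w μ i := by
  unfold resMult
  split_ifs with h
  · rcases hμ : μ i with _ | k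
    · simp
    · rw [hμ] at hg
      exact mem_of_linForm_mul_mem_succ hc hw hg
  · exact mem_of_linForm_mul_mem h hg

lemma expDeg_eq_add {s : ℕ} {V : Submodule K (Fin (3 + 1) → K)} {c : Fin (3 + 1) → K}
    (hc : ∀ x, x ∈ V ↔ c ⬝ᵥ x = 0) (p : Fin s → Projectivization K (Fin (3 + 1) → K))
    (m : Fin s → ℕ) :
    expDeg 3 m = expDeg 3 (resMult c (fun i => (p i).rep) m) + expDeg 2 (multIn V p m) := by
  rw [expDeg, expDeg, expDeg, ← Finset.sum_add_distrib]
  refine Finset.sum_congr rfl fun i _ => ?_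
  have h : p i ∈ projSet V ↔ c ⬝ᵥ (p i).rep = 0 := hc _
  unfold resMult multIn
  by_cases hi : c ⬝ᵥ (p i).rep = 0
  · rw [if_pos hi, if_pos (h.2 hi)]
    rcases m i with _ | k
    · rfl
    · rw [show 3 + (k + 1) - 1 = (k + 2) + 1 by omega, Nat.choose_succ_succ, add_comm,
        show 3 + (k + 1 - 1) - 1 = k + 2 by omega, show 2 + (k + 1) - 1 = k + 2 by omega]
  · rw [if_neg hi, if_neg (mt h.1 hi)]
    rfl

end Castelnuovo

section Main

lemma hilbDim_fatIdeal_le {n s : ℕ} (hn : 0 < n) (p : Fin s → Projectivization K (Fin (n + 1) → K))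
    (m : Fin s → ℕ) (d : ℕ) : hilbDim (fatIdeal p m) d ≤ expDeg n m := by
  have h := hilbDim_iInf_le (fun i => pointIdeal (p i) ^ m i) d Finset.univ
  simp only [Finset.mem_univ, iInf_pos] at h
  exact h.trans (Finset.sum_le_sum fun i _ =>
    hilbDim_vecIdeal_pow_le hn (p i).rep_nonzero (m i) d)

lemma hilbDim_add_expDeg_le {s : ℕ} {d : ℕ} {p : Fin s → Projectivization K (Fin 4 → K)}
    {m : Fin s → ℕ} {V : Submodule K (Fin 4 → K)} (hV : finrank K V = 3) {c : Fin 4 → K}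
    (hc0 : c ≠ 0) (hc : ∀ x, x ∈ V ↔ c ⬝ᵥ x = 0) (hH : H1ZeroIn 2 V p (multIn V p m) (d + 1)) :
    hilbDim (⨅ i, vecIdeal (p i).rep ^ resMult c (fun i => (p i).rep) m i) d +
      expDeg 2 (multIn V p m) ≤ hilbDim (fatIdeal p m) (d + 1) := by
  have e : (Fin (2 + 1) → K) ≃ₗ[K] V := LinearEquiv.ofFinrankEq _ _ (by simp [hV])
  obtain ⟨q, hq, hqH⟩ := hH e
  have hinj : Function.Injective (V.subtype ∘ₗ (e : (Fin (2 + 1) → K) →ₗ[K] V)) :=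
    V.injective_subtype.comp e.injective
  obtain ⟨g, hg⟩ := LinearMap.exists_leftInverse_of_injective _ (LinearMap.ker_eq_bot.2 hinj)
  rw [← show hilbDim (fatIdeal q (multIn V p m)) (d + 1) = _ from hqH]
  refine hilbDim_add_le (E := LinearMap.toMatrix' (V.subtype ∘ₗ e.toLinearMap))
    (B := LinearMap.toMatrix' g) (c := c) ?_ ?_ ?_ ?_ d
  · rw [← LinearMap.toMatrix'_comp]
    exact (congrArg _ hg).trans LinearMap.toMatrix'_id
  · ext j
    exact (hc _).1 (by
      change (fun i => LinearMap.toMatrix' (V.subtype ∘ₗ e.toLinearMap) i j) ∈ V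
      simp only [LinearMap.toMatrix'_apply]
      exact (e _).2)
  · intro f hf
    rw [fatIdeal, Submodule.mem_iInf] at hf
    exact (Submodule.mem_iInf _).2 fun i =>
      resMult_mem_of_linForm_mul_mem hc0 (w := fun i => (p i).rep) (p i).rep_nonzero (hf i)
  · intro f hf
    rw [fatIdeal, Submodule.mem_iInf] at hf ⊢
    intro i
    by_cases hi : multIn V p m i = 0
    · simp [hi]
    · refine linSubst_mem_of_map_eq hinj (hq i hi) _ ?_
      have hle : multIn V p m i ≤ m i := by unfold multIn; split_ifs <;> omega
      exact Ideal.pow_le_pow_right hle (hf i)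

lemma rep_notMem_span {n : ℕ} {p q : Projectivization K (Fin (n + 1) → K)} (h : p ≠ q) :
    p.rep ∉ Submodule.span K {q.rep} := by
  intro hmem
  obtain ⟨a, ha⟩ := Submodule.mem_span_singleton.1 hmem
  refine h ?_
  rw [← p.mk_rep, ← q.mk_rep]
  exact (Projectivization.mk_eq_mk_iff' K _ _ _ _).2 ⟨a, ha⟩

end Main

/-- **Proposition `ccc12`** (the modified Segre conjecture holds for `n = 3`).
Let `d ≥ 2` and let `Z = Σ m_i p_i` be a fat point scheme on distinct points of `ℙ³` with
(1) `w(Z) ≤ 3d + 1`;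
(2) `w_L(Z) ≤ d + 1` for every line `L`;
(3) `w_L(Z) ≤ 2d + 2` for every plane `L`, and whenever `w_L(Z) = 2d + 2` the restricted
scheme `Z ∩ L` satisfies `h¹(L, I_{Z∩L}(d)) = 0`.
Then `h¹(I_Z(d)) = 0`. -/
theorem modified_segre_conjecture_P3 {K : Type*} [Field K] [IsAlgClosed K] {d s : ℕ}
    (hd : 2 ≤ d)
    (p : Fin s → Projectivization K (Fin 4 → K)) (hinj : Function.Injective p)
    (m : Fin s → ℕ) (hm : ∀ i, 1 ≤ m i)
    (h1 : (∑ i, m i) ≤ 3 * d + 1)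
    (h2 : ∀ V : Submodule K (Fin 4 → K), Module.finrank K V = 2 →
      weightIn p m (projSet V) ≤ d + 1)
    (h3 : ∀ V : Submodule K (Fin 4 → K), Module.finrank K V = 3 →
      weightIn p m (projSet V) ≤ 2 * d + 2 ∧
        (weightIn p m (projSet V) = 2 * d + 2 → H1ZeroIn 2 V p (multIn V p m) d)) :
    H1Zero p m d := by
  have hr : ∀ i j, i ≠ j → (p i).rep ∉ Submodule.span K {(p j).rep} :=
    fun i j hij => rep_notMem_span (hinj.ne hij)
  by_cases hV : ∃ V : Submodule K (Fin 4 → K), finrank K V = 3 ∧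
      weightIn p m (projSet V) = 2 * d + 2
  · obtain ⟨V, hV, hVm⟩ := hV
    obtain ⟨d, rfl⟩ : ∃ k, d = k + 1 := ⟨d - 1, by omega⟩
    obtain ⟨c, hc0, hc⟩ := exists_mem_iff_dotProduct_eq_zero hV
    obtain ⟨h1', h2', h3'⟩ := residual_bounds h1 (r := fun i => (p i).rep) h2 hV hVm
      (resMult_le c _ m) fun i hi => resMult_lt ((hc _).1 hi)
    have h := hilbDim_add_expDeg_le hV hc0 hc ((h3 V hV).2 hVm)
    rw [hilbDim_iInf_vecIdeal_eq_of_plane_lt (fun i => (p i).rep_nonzero) hr h1' h2' h3'] at h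
    exact le_antisymm (hilbDim_fatIdeal_le (by omega) p m _) ((expDeg_eq_add hc p m).trans_le h)
  · refine hilbDim_iInf_vecIdeal_eq_of_plane_lt (fun i => (p i).rep_nonzero) hr h1 h2
      fun V hV3 => ?_
    have h := (h3 V hV3).1
    have hne : weightIn p m (projSet V) ≠ 2 * d + 2 := fun h => hV ⟨V, hV3, h⟩
    exact Nat.le_of_lt_succ (lt_of_le_of_ne h hne)
end

section
/- Fix integers n ≥ 3 and d ≥ 2, and set s = (n−1)d + 3. Then there exist distinct points p, q_1, …, q_{s−1} of P^n such that the set S = {p, q_1, …, q_{s−1}} is in uniform position, S is not contained in any rational normal curve of degree n of P^n, and the fat point scheme Z = d·p + q_1 + ⋯ + q_{s−1} satisfies h^1(I_Z(d)) = 1, i.e. dim_K (R/I_Z)_d = C(n+d−1, n) + (s − 1) − 1. -/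
open MvPolynomial Module

variable {K : Type*} [Field K]

/-- `C` is a rational normal curve of degree `m` in `ℙⁿ` (`1 ≤ m ≤ n`): the image of the
composite of the degree-`m` Veronese map `ℙ¹ → ℙᵐ`, `[s:t] ↦ [sᵐ : sᵐ⁻¹t : ⋯ : tᵐ]`, with an
injective projective-linear embedding `ℙᵐ → ℙⁿ`. -/
def IsRNC (n m : ℕ) (C : Set (Projectivization K (Fin (n + 1) → K))) : Prop :=
  ∃ g : (Fin (m + 1) → K) →ₗ[K] (Fin (n + 1) → K), Function.Injective g ∧
    C = {x | ∃ s t : K, (s ≠ 0 ∨ t ≠ 0) ∧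
      ∃ h : g (fun j => s ^ (m - (j : ℕ)) * t ^ (j : ℕ)) ≠ 0,
        x = Projectivization.mk K (g (fun j => s ^ (m - (j : ℕ)) * t ^ (j : ℕ))) h}

/-- A finite set `S ⊂ ℙⁿ` is in uniform position if any two subsets of the same cardinality
have the same Hilbert function (computed from their saturated radical ideals). -/
def UniformPosition {n : ℕ} (S : Set (Projectivization K (Fin (n + 1) → K))) : Prop :=
  ∀ E F : Finset (Projectivization K (Fin (n + 1) → K)), ↑E ⊆ S → ↑F ⊆ S →
    E.card = F.card → ∀ t : ℕ,
      hilbDim (⨅ x ∈ E, pointIdeal x) t = hilbDim (⨅ x ∈ F, pointIdeal x) t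

section LinearAlgebra

variable {K V V' : Type*} [Field K] [AddCommGroup V] [Module K V] [AddCommGroup V'] [Module K V']

theorem finrank_map_add_finrank_inf_ker (φ : V →ₗ[K] V') (U : Submodule K V)
    [FiniteDimensional K U] :
    finrank K (U.map φ) + finrank K ↥(U ⊓ LinearMap.ker φ) = finrank K U := by
  have h := (φ.domRestrict U).finrank_range_add_finrank_ker
  rw [LinearMap.range_domRestrict] at h
  rw [← h, LinearMap.ker_domRestrict]
  congr 1
  rw [← Submodule.map_comap_subtype]
  exact ((LinearMap.ker φ).comap U.subtype |>.equivMapOfInjective _ U.injective_subtype).finrank_eq.symm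

theorem finrank_inf_ker_le (φ : V →ₗ[K] K) (U : Submodule K V) [FiniteDimensional K U] :
    finrank K U ≤ finrank K ↥(U ⊓ LinearMap.ker φ) + 1 := by
  have h := finrank_map_add_finrank_inf_ker φ U
  have h1 : finrank K (U.map φ) ≤ finrank K K := Submodule.finrank_le _
  rw [finrank_self] at h1
  omega

theorem finrank_inf_ker_add_one (φ : V →ₗ[K] K) (U : Submodule K V) [FiniteDimensional K U]
    (hU : ∃ u ∈ U, φ u ≠ 0) : finrank K ↥(U ⊓ LinearMap.ker φ) + 1 = finrank K U := by
  obtain ⟨u, hu, hφ⟩ := hU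
  have h := finrank_map_add_finrank_inf_ker φ U
  have h1 : finrank K (U.map φ) ≤ finrank K K := Submodule.finrank_le _
  have h2 : 0 < finrank K (U.map φ) := by
    rw [finrank_pos_iff_exists_ne_zero]
    exact ⟨⟨φ u, Submodule.mem_map_of_mem hu⟩, fun h => hφ (congrArg Subtype.val h)⟩
  rw [finrank_self] at h1
  omega

end LinearAlgebra

section Homogeneous

theorem aeval_mul_right_of_isHomogeneous {K A σ : Type*} [CommSemiring K]
    [CommSemiring A] [Algebra K A] {f : MvPolynomial σ K} {d : ℕ} (hf : f.IsHomogeneous d)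
    (v : σ → A) (c : A) : aeval (fun i => v i * c) f = aeval v f * c ^ d := by
  simp only [aeval_def, eval₂_eq, Finset.sum_mul]
  refine Finset.sum_congr rfl fun m hm => ?_
  have := hf.degree_eq_sum_deg_support hm
  simp only [mul_pow, Finset.prod_mul_distrib, Finset.prod_pow_eq_pow_sum, mul_assoc]
  rw [this]

instance {σ K : Type*} [Finite σ] [Field K] (d : ℕ) :
    FiniteDimensional K (homogeneousSubmodule σ K d) :=
  Module.Finite.iff_fg.mpr (homogeneousSubmodule_fg σ K d)

theorem finrank_homogeneousSubmodule_fin (K : Type*) [Field K] (m d : ℕ) :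
    finrank K (homogeneousSubmodule (Fin m) K d) = Nat.choose (m + d - 1) d := by
  have h1 : finrank K ({e : Fin m →₀ ℕ | e.degree = d} →₀ K) =
      Nat.card {e : Fin m →₀ ℕ | e.degree = d} :=
    finrank_eq_nat_card_basis Finsupp.basisSingleOne
  have h2 : {e : Fin m →₀ ℕ | e.degree = d} ≃ Sym (Fin m) d :=
    (Equiv.subtypeEquivRight fun e => by simp [Finsupp.degree_eq_sum, Finsupp.sum_fintype]).trans
      (Sym.equivNatSum (Fin m) d).symm
  rw [homogeneousSubmodule_eq_finsupp_supported,
    (AddMonoidAlgebra.supportedEquivFinsupp _).finrank_eq, h1, Nat.card_congr h2,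
    Nat.card_eq_fintype_card, Sym.card_sym_eq_choose, Fintype.card_fin]

theorem hilbDim_add_finrank {n : ℕ} (I : Ideal (MvPolynomial (Fin (n + 1)) K)) (d : ℕ)
    (W : Submodule K (MvPolynomial (Fin (n + 1)) K))
    (hW : ∀ f, f ∈ W ↔ f.IsHomogeneous d ∧ f ∈ I) :
    hilbDim I d + finrank K W = Nat.choose (n + d) d := by
  have h := finrank_map_add_finrank_inf_ker (Ideal.Quotient.mkₐ K I).toLinearMap
    (homogeneousSubmodule (Fin (n + 1)) K d)
  rw [finrank_homogeneousSubmodule_fin, show n + 1 + d - 1 = n + d by omega] at h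
  have hW' : W = homogeneousSubmodule (Fin (n + 1)) K d ⊓
      LinearMap.ker (Ideal.Quotient.mkₐ K I).toLinearMap := by
    ext f
    simp [hW, Ideal.Quotient.eq_zero_iff_mem]
  rw [← h, hilbDim, hW']

end Homogeneous

section PointIdeal

theorem linearForm_mem_pointIdeal {n : ℕ} (p : Projectivization K (Fin (n + 1) → K))
    (c : Fin (n + 1) → K) (hc : ∑ i, c i * p.rep i = 0) :
    ∑ i, MvPolynomial.C (c i) * MvPolynomial.X i ∈ pointIdeal p :=
  Ideal.subset_span ⟨c, hc, rfl⟩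

theorem pointIdeal_le_ker {n : ℕ} (p : Projectivization K (Fin (n + 1) → K)) :
    pointIdeal p ≤ RingHom.ker (aeval (R := K) p.rep) := by
  rw [pointIdeal, Ideal.span_le]
  rintro f ⟨c, hc, rfl⟩
  simpa using hc

theorem mem_pointIdeal_of_aeval_rep_eq_zero {n d : ℕ} (p : Projectivization K (Fin (n + 1) → K))
    {f : MvPolynomial (Fin (n + 1)) K} (hf : f.IsHomogeneous d) (h : aeval p.rep f = 0) :
    f ∈ pointIdeal p := by
  obtain ⟨k, hk⟩ := Function.ne_iff.mp p.rep_nonzero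
  simp only [Pi.zero_apply] at hk
  set π := Ideal.Quotient.mkₐ K (pointIdeal p)
  have hX : ∀ i, π (X i) = algebraMap K _ (p.rep i) * (algebraMap K _ (p.rep k)⁻¹ * π (X k)) := by
    intro i
    have hmem : X i - MvPolynomial.C (p.rep i * (p.rep k)⁻¹) * X k ∈ pointIdeal p := by
      have := linearForm_mem_pointIdeal p
        (Pi.single i 1 - Pi.single k (p.rep i * (p.rep k)⁻¹)) (by
          simp [sub_mul, Finset.sum_sub_distrib, Pi.single_apply, hk])
      simpa [sub_mul, Finset.sum_sub_distrib, Pi.single_apply, apply_ite MvPolynomial.C] using this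
    have h0 : π (X i - MvPolynomial.C (p.rep i * (p.rep k)⁻¹) * X k) = 0 :=
      Ideal.Quotient.eq_zero_iff_mem.mpr hmem
    rw [map_sub, sub_eq_zero] at h0
    rw [h0, ← mul_assoc, ← map_mul, map_mul π]
    rfl
  have h1 : π f = aeval (fun i => π (X i)) f := by
    rw [← MvPolynomial.comp_aeval_apply, aeval_X_left_apply]
  have h2 : aeval (fun i => algebraMap K (_ ⧸ pointIdeal p) (p.rep i)) f = 0 := by
    exact (MvPolynomial.aeval_algebraMap_apply _ p.rep f).trans (by rw [h, map_zero])
  rw [funext hX] at h1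
  rw [aeval_mul_right_of_isHomogeneous hf, h2, zero_mul] at h1
  exact Ideal.Quotient.eq_zero_iff_mem.mp h1

theorem mem_pointIdeal_mk_iff {n d : ℕ} {v : Fin (n + 1) → K} (hv : v ≠ 0)
    {f : MvPolynomial (Fin (n + 1)) K} (hf : f.IsHomogeneous d) :
    f ∈ pointIdeal (Projectivization.mk K v hv) ↔ aeval v f = 0 := by
  set p := Projectivization.mk K v hv
  obtain ⟨c, hc⟩ := Projectivization.exists_smul_eq_mk_rep K v hv
  have hrep : p.rep = fun i => v i * (c : K) := by
    rw [← hc]; ext i; simp [Units.smul_def, mul_comm]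
  have : aeval p.rep f = 0 ↔ aeval v f = 0 := by
    rw [hrep, aeval_mul_right_of_isHomogeneous hf]
    simp
  rw [← this]
  exact ⟨fun h => pointIdeal_le_ker p h, mem_pointIdeal_of_aeval_rep_eq_zero p hf⟩

end PointIdeal
section CuspidalCurve

/-- The affine parametrization `s ↦ (1, s², s³, …, s^{n+1})` of a cuspidal rational curve. -/
def cuspCurve {A : Type*} [CommSemiring A] (n : ℕ) (s : A) : Fin (n + 1) → A :=
  Fin.cons 1 fun j => s ^ ((j : ℕ) + 2)

@[simp]
theorem cuspCurve_zero {A : Type*} [CommSemiring A] (n : ℕ) (s : A) : cuspCurve n s 0 = 1 := rfl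

@[simp]
theorem cuspCurve_succ {A : Type*} [CommSemiring A] (n : ℕ) (s : A) (j : Fin n) :
    cuspCurve n s j.succ = s ^ ((j : ℕ) + 2) := rfl

theorem cuspCurve_ne_zero (n : ℕ) (s : K) : cuspCurve n s ≠ 0 :=
  fun h => one_ne_zero (congrFun h 0)

/-- The point of projective space with homogeneous coordinates `cuspCurve n s`. -/
def cuspPoint (n : ℕ) (s : K) : Projectivization K (Fin (n + 1) → K) :=
  Projectivization.mk K (cuspCurve n s) (cuspCurve_ne_zero n s)

theorem cuspPoint_injective {n : ℕ} (hn : 2 ≤ n) :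
    Function.Injective (cuspPoint n : K → Projectivization K (Fin (n + 1) → K)) := by
  intro s t h
  obtain ⟨a, ha⟩ := (Projectivization.mk_eq_mk_iff' K _ _ _ _).mp h
  have h0 : a = 1 := by simpa using congrFun ha 0
  subst h0
  rw [one_smul] at ha
  have h2 : t ^ 2 = s ^ 2 := by simpa using congrFun ha (Fin.succ ⟨0, by omega⟩)
  have h3 : t ^ 3 = s ^ 3 := by simpa using congrFun ha (Fin.succ ⟨1, by omega⟩)
  by_cases hs : s = 0
  · subst hs
    exact (by simpa using h2 : t = 0).symm
  · have : s ^ 2 * t = s ^ 2 * s := by linear_combination -t * h2 + h3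
    exact (mul_left_cancel₀ (pow_ne_zero 2 hs) this).symm

/-- Forms of degree `t` vanishing at the points of the cuspidal curve with parameter in `E`. -/
noncomputable def vanishingForms (n t : ℕ) (E : Set K) : Submodule K (MvPolynomial (Fin (n + 1)) K) :=
  homogeneousSubmodule (Fin (n + 1)) K t ⊓
    ⨅ s ∈ E, LinearMap.ker (aeval (R := K) (cuspCurve n s)).toLinearMap

theorem mem_vanishingForms {n t : ℕ} {E : Set K} {f : MvPolynomial (Fin (n + 1)) K} :
    f ∈ vanishingForms n t E ↔ f.IsHomogeneous t ∧ ∀ s ∈ E, aeval (cuspCurve n s) f = 0 := by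
  simp [vanishingForms]

instance (n t : ℕ) (E : Set K) : FiniteDimensional K (vanishingForms n t E) :=
  Submodule.finiteDimensional_of_le (S₂ := homogeneousSubmodule (Fin (n + 1)) K t) inf_le_left

theorem vanishingForms_anti (n t : ℕ) {E F : Set K} (h : E ⊆ F) :
    vanishingForms n t F ≤ vanishingForms n t E := fun _ hf =>
  mem_vanishingForms.mpr ⟨(mem_vanishingForms.mp hf).1,
    fun s hs => (mem_vanishingForms.mp hf).2 s (h hs)⟩

theorem vanishingForms_insert (n t : ℕ) (E : Set K) (s : K) :
    vanishingForms n t (insert s E) =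
      vanishingForms n t E ⊓ LinearMap.ker (aeval (R := K) (cuspCurve n s)).toLinearMap := by
  ext f
  simp only [mem_vanishingForms, Set.forall_mem_insert, Submodule.mem_inf, LinearMap.mem_ker,
    AlgHom.toLinearMap_apply]
  tauto

theorem finrank_vanishingForms_empty (n t : ℕ) :
    finrank K (vanishingForms n t ((∅ : Finset K) : Set K)) = Nat.choose (n + t) t := by
  have h : vanishingForms n t ((∅ : Finset K) : Set K) = homogeneousSubmodule (Fin (n + 1)) K t := by
    simp [vanishingForms]
  rw [h, finrank_homogeneousSubmodule_fin]
  congr 1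
  omega

open Classical in
theorem le_finrank_vanishingForms (n t : ℕ) (E : Finset K) :
    Nat.choose (n + t) t ≤ finrank K (vanishingForms n t (E : Set K)) + E.card := by
  induction E using Finset.induction_on with
  | empty => rw [finrank_vanishingForms_empty, Finset.card_empty, add_zero]
  | insert s E hs ih =>
    have := finrank_inf_ker_le (aeval (R := K) (cuspCurve n s)).toLinearMap
      (vanishingForms n t (E : Set K))
    rw [Finset.coe_insert, vanishingForms_insert, Finset.card_insert_of_notMem hs]
    omega

open Classical in
theorem finrank_vanishingForms_of_card_le {n : ℕ} (hn : 2 ≤ n) (t : ℕ) (E : Finset K)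
    (hE : E.card ≤ t) :
    finrank K (vanishingForms n t (E : Set K)) + E.card = Nat.choose (n + t) t := by
  induction E using Finset.induction_on with
  | empty => rw [finrank_vanishingForms_empty, Finset.card_empty, add_zero]
  | insert s E hs ih =>
    rw [Finset.card_insert_of_notMem hs] at hE ⊢
    have key := finrank_inf_ker_add_one (aeval (R := K) (cuspCurve n s)).toLinearMap
      (vanishingForms n t (E : Set K)) ?_
    · have := ih (by omega)
      rw [Finset.coe_insert, vanishingForms_insert]
      omega
    have hlin : ∀ y ∈ E, ∃ l : MvPolynomial (Fin (n + 1)) K, l.IsHomogeneous 1 ∧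
        aeval (cuspCurve n y) l = 0 ∧ aeval (cuspCurve n s) l ≠ 0 := by
      intro y hy
      by_contra! hcon
      refine hs ?_
      have : s = y := by
        apply cuspPoint_injective hn
        have h (i : Fin (n + 1)) := hcon (X i - MvPolynomial.C (cuspCurve n y i) * X 0)
          ((isHomogeneous_X K i).sub (isHomogeneous_C_mul_X _ 0)) (by simp)
        have : cuspCurve n s = cuspCurve n y := by
          ext i
          simpa [sub_eq_zero] using h i
        simp [cuspPoint, this]
      rwa [this]
    choose! l hl1 hl2 hl3 using hlin
    refine ⟨X 0 ^ (t - E.card) * ∏ y ∈ E, l y, mem_vanishingForms.mpr ⟨?_, ?_⟩, ?_⟩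
    · convert ((isHomogeneous_X K (0 : Fin (n + 1))).pow (t - E.card)).mul
        (IsHomogeneous.prod E l (fun _ => 1) hl1)
      simp
      omega
    · intro y hy
      rw [map_mul, map_prod, Finset.prod_eq_zero hy (hl2 y hy), mul_zero]
    · simpa [Finset.prod_eq_zero_iff] using hl3

theorem aeval_cuspCurve_polynomial (n : ℕ) (f : MvPolynomial (Fin (n + 1)) K) (s : K) :
    (aeval (cuspCurve n (Polynomial.X : Polynomial K)) f).eval s = aeval (cuspCurve n s) f := by
  rw [← Polynomial.coe_evalRingHom, ← Polynomial.coe_aeval_eq_evalRingHom]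
  change (Polynomial.aeval s) _ = _
  rw [MvPolynomial.comp_aeval_apply]
  congr 2
  ext i
  refine Fin.cases ?_ (fun j => ?_) i <;> simp

/-- The forms of degree at most `T` vanishing on a subset `E` of `A` either vanish on the whole
curve or are cut out by independent conditions. -/
def InGeneralPosition (n T : ℕ) (A : Finset K) : Prop :=
  ∀ E ⊆ A, ∀ t ≤ T, vanishingForms n t (E : Set K) = vanishingForms n t Set.univ ∨
    finrank K (vanishingForms n t (E : Set K)) + E.card = Nat.choose (n + t) t

open Classical in
theorem InGeneralPosition.insert {n T : ℕ} {A : Finset K} (hA : InGeneralPosition n T A) {s : K}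
    (hs : s ∉ A)
    (h : ∀ E ⊆ A, ∀ t ≤ T, vanishingForms n t (E : Set K) ≠ vanishingForms n t Set.univ →
      ∃ f ∈ vanishingForms n t (E : Set K), aeval (cuspCurve n s) f ≠ 0) :
    InGeneralPosition n T (insert s A) := by
  intro E hE t ht
  by_cases hsE : s ∈ E
  · obtain ⟨F, hsF, rfl⟩ : ∃ F, s ∉ F ∧ Insert.insert s F = E :=
      ⟨E.erase s, Finset.notMem_erase s E, Finset.insert_erase hsE⟩
    have hFA : F ⊆ A := fun x hx => by
      rcases Finset.mem_insert.mp (hE (Finset.mem_insert_of_mem hx)) with rfl | h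
      · exact absurd hx hsF
      · exact h
    by_cases hF : vanishingForms n t (F : Set K) = vanishingForms n t Set.univ
    · left
      refine le_antisymm ?_ (vanishingForms_anti n t (Set.subset_univ _))
      rw [← hF]
      exact vanishingForms_anti n t (by simp)
    · right
      have h1 := (hA F hFA t ht).resolve_left hF
      have h2 := finrank_inf_ker_add_one (aeval (R := K) (cuspCurve n s)).toLinearMap
        (vanishingForms n t (F : Set K)) (h F hFA t ht hF)
      rw [Finset.coe_insert, vanishingForms_insert, Finset.card_insert_of_notMem hsF]
      omega
  · exact hA E ((Finset.subset_insert_iff_of_notMem hsE).mp hE) t ht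

open Classical in
theorem exists_inGeneralPosition [Infinite K] (n T k : ℕ) :
    ∃ A : Finset K, A.card = k + 1 ∧ 0 ∈ A ∧ InGeneralPosition n T A := by
  induction k with
  | zero =>
    refine ⟨{0}, by simp, by simp, ?_⟩
    have h0 : InGeneralPosition n T (∅ : Finset K) := by
      intro E hE t _
      rw [Finset.subset_empty] at hE
      subst hE
      right
      rw [finrank_vanishingForms_empty, Finset.card_empty, add_zero]
    refine h0.insert (by simp) fun E hE t _ _ => ⟨X 0 ^ t, ?_, by simp⟩
    rw [Finset.subset_empty] at hE
    subst hE
    simpa [mem_vanishingForms] using isHomogeneous_X_pow (R := K) (0 : Fin (n + 1)) t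
  | succ k ih =>
    obtain ⟨A, hcard, h0, hA⟩ := ih
    have hf : ∀ E : Finset K, ∀ t : ℕ, ∃ f : MvPolynomial (Fin (n + 1)) K,
        vanishingForms n t (E : Set K) ≠ vanishingForms n t Set.univ →
        f ∈ vanishingForms n t (E : Set K) ∧
          aeval (cuspCurve n (Polynomial.X : Polynomial K)) f ≠ 0 := by
      intro E t
      by_contra! hcon
      have hne := (hcon 0).1
      refine hne (le_antisymm (fun f hf => ?_) (vanishingForms_anti n t (Set.subset_univ _)))
      refine mem_vanishingForms.mpr ⟨(mem_vanishingForms.mp hf).1, fun s _ => ?_⟩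
      rw [← aeval_cuspCurve_polynomial, (hcon f).2 hf, Polynomial.eval_zero]
    choose f hf using hf
    obtain ⟨s, hs⟩ := Infinite.exists_notMem_finset
      (A ∪ A.powerset.biUnion fun E => (Finset.range (T + 1)).biUnion fun t =>
        (aeval (cuspCurve n (Polynomial.X : Polynomial K)) (f E t)).roots.toFinset)
    simp only [Finset.mem_union, Finset.mem_biUnion, not_or, not_exists, not_and,
      Finset.mem_powerset, Finset.mem_range] at hs
    refine ⟨insert s A, by rw [Finset.card_insert_of_notMem hs.1, hcard], by simp [h0],
      hA.insert hs.1 fun E hE t ht hne => ⟨f E t, (hf E t hne).1, fun h => ?_⟩⟩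
    refine hs.2 E hE t (by omega) ?_
    rw [Multiset.mem_toFinset, Polynomial.mem_roots (hf E t hne).2, Polynomial.IsRoot.def,
      aeval_cuspCurve_polynomial, h]

open Classical in
theorem uniformPosition_image_cuspPoint {n : ℕ} (hn : 2 ≤ n) {A : Finset K}
    (hA : InGeneralPosition n A.card A) : UniformPosition (cuspPoint n '' (A : Set K)) := by
  have hdim : ∀ E : Finset K, ∀ t,
      hilbDim (⨅ x ∈ E.image (cuspPoint n), pointIdeal x) t +
        finrank K (vanishingForms n t (E : Set K)) = Nat.choose (n + t) t := by
    intro E t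
    refine hilbDim_add_finrank _ _ _ fun f => ?_
    rw [mem_vanishingForms]
    refine and_congr_right fun hf => ?_
    simp only [Ideal.mem_iInf, Finset.mem_image, forall_exists_index, and_imp,
      forall_apply_eq_imp_iff₂, Finset.mem_coe]
    exact forall₂_congr fun s _ => (mem_pointIdeal_mk_iff (cuspCurve_ne_zero n s) hf).symm
  have hgen : ∀ E ⊆ A, ∀ t,
      vanishingForms n t (E : Set K) = vanishingForms n t Set.univ ∨
        finrank K (vanishingForms n t (E : Set K)) + E.card = Nat.choose (n + t) t := by
    intro E hE t
    rcases le_total t A.card with h | h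
    · exact hA E hE t h
    · exact Or.inr (finrank_vanishingForms_of_card_le hn t E ((Finset.card_le_card hE).trans h))
  have hle : ∀ E ⊆ A, ∀ F ⊆ A, E.card = F.card → ∀ t,
      finrank K (vanishingForms n t (E : Set K)) ≤ finrank K (vanishingForms n t (F : Set K)) := by
    intro E hE F _ hcard t
    rcases hgen E hE t with h | h
    · rw [h]
      exact Submodule.finrank_mono (vanishingForms_anti n t (Set.subset_univ _))
    · have := le_finrank_vanishingForms n t F
      omega
  intro E F hE hF hcard t
  obtain ⟨E, hE', rfl⟩ := Finset.subset_set_image_iff.mp hE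
  obtain ⟨F, hF', rfl⟩ := Finset.subset_set_image_iff.mp hF
  rw [Finset.coe_subset] at hE' hF'
  rw [Finset.card_image_of_injective _ (cuspPoint_injective hn),
    Finset.card_image_of_injective _ (cuspPoint_injective hn)] at hcard
  have h1 := hdim E t
  have h2 := hdim F t
  have h3 := hle E hE' F hF' hcard t
  have h4 := hle F hF' E hE' hcard.symm t
  omega

end CuspidalCurve
section RationalNormalCurve

/-- Evaluation at a point of the projective line of a polynomial viewed as a binary form of
degree `n`, where `none` is the point at infinity. -/
def evalOption (n : ℕ) (o : Option K) (f : Polynomial K) : K :=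
  o.elim (f.coeff n) fun z => f.eval z

theorem evalOption_mul {m n : ℕ} {f g : Polynomial K} (hf : f.natDegree ≤ m)
    (hg : g.natDegree ≤ n) (o : Option K) :
    evalOption (m + n) o (f * g) = evalOption m o f * evalOption n o g := by
  cases o with
  | none => exact Polynomial.coeff_mul_add_eq_of_natDegree_le hf hg
  | some z => exact Polynomial.eval_mul

theorem evalOption_sub (n : ℕ) (f g : Polynomial K) (o : Option K) :
    evalOption n o (f - g) = evalOption n o f - evalOption n o g := by
  cases o <;> simp [evalOption]

theorem eq_zero_of_evalOption_eq_zero {m : ℕ} {f : Polynomial K} (hf : f.natDegree ≤ m)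
    (B : Finset (Option K)) (hB : m < B.card) (h : ∀ o ∈ B, evalOption m o f = 0) : f = 0 := by
  classical
  by_contra hne
  have hcard : f.natDegree < (Finset.eraseNone B).card := by
    by_cases hnone : none ∈ B
    · rw [Finset.card_eraseNone_of_mem hnone]
      have h0 : f.coeff m = 0 := h none hnone
      have : f.natDegree ≠ m := by
        rintro rfl
        exact hne (Polynomial.leadingCoeff_eq_zero.mp h0)
      omega
    · rw [Finset.card_eraseNone_of_not_mem hnone]
      omega
  exact hne (Polynomial.eq_zero_of_natDegree_lt_card_of_eval_eq_zero' f _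
    (fun z hz => h (some z) (Finset.mem_eraseNone.mp hz)) hcard)

/-- If the binary forms `a, y₀, …, y_{n-1}` of degree at most `n` satisfy the quadratic equations
of the curve `(1, z², z³, …, z^{n+1})`, then `y₀` and `y₁` are linearly dependent. -/
theorem eq_zero_or_eq_C_mul_of_cusp_relations {n : ℕ} (hn : 3 ≤ n) {a : Polynomial K}
    {y : ℕ → Polynomial K} (ha : a.natDegree ≤ n) (hy : (y (n - 1)).natDegree ≤ n)
    (h2 : y 0 * y 0 = a * y 2) (hstep : ∀ j, j + 1 < n → y 0 * y (j + 1) = y 1 * y j) :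
    y 0 = 0 ∨ ∃ c : K, y 1 = Polynomial.C c * y 0 := by
  classical
  by_cases h0 : y 0 = 0
  · exact Or.inl h0
  right
  have hpow : ∀ j < n, y j * y 0 ^ j = y 1 ^ j * y 0 := by
    intro j
    induction j with
    | zero => simp
    | succ j ih =>
      intro hj
      linear_combination y 0 ^ j * hstep j hj + y 1 * ih (by omega)
  obtain ⟨D, A, B, hA, hB, hAB⟩ : ∃ D A B, y 0 = D * A ∧ y 1 = D * B ∧ IsCoprime A B := by
    let := EuclideanDomain.gcdMonoid (Polynomial K)
    have hgcd : gcd (y 1) (y 0) ≠ 0 := fun h => h0 ((gcd_eq_zero_iff _ _).mp h).2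
    exact ⟨gcd (y 1) (y 0), y 0 / gcd (y 1) (y 0), y 1 / gcd (y 1) (y 0),
      (EuclideanDomain.mul_div_cancel' hgcd (gcd_dvd_right _ _)).symm,
      (EuclideanDomain.mul_div_cancel' hgcd (gcd_dvd_left _ _)).symm,
      (isCoprime_div_gcd_div_gcd h0).symm⟩
  have hD0 : D ≠ 0 := left_ne_zero_of_mul (hA ▸ h0)
  have hA0 : A ≠ 0 := right_ne_zero_of_mul (hA ▸ h0)
  have hyA : ∀ j < n, y j * A ^ j = B ^ j * D * A := by
    intro j hj
    refine mul_left_cancel₀ (pow_ne_zero j hD0) ?_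
    have := hpow j hj
    rw [hA, hB, mul_pow, mul_pow] at this
    linear_combination this
  have hDA : A ^ 3 * D = a * B ^ 2 := by
    refine mul_left_cancel₀ (mul_ne_zero hD0 hA0) ?_
    have h3 := hyA 2 (by omega)
    rw [hA] at h2
    linear_combination A ^ 2 * h2 + a * h3
  obtain ⟨a₁, ha₁⟩ : A ^ 3 ∣ a :=
    (hAB.pow (m := 3) (n := 2)).dvd_of_dvd_mul_right ⟨D, hDA.symm⟩
  have hD : D = a₁ * B ^ 2 := by
    refine mul_left_cancel₀ (pow_ne_zero 3 hA0) ?_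
    rw [hDA, ha₁]
    ring
  obtain ⟨k, rfl⟩ : ∃ k, n = k + 3 := ⟨n - 3, by omega⟩
  have hlast : y (k + 2) * A ^ (k + 1) = a₁ * B ^ (k + 4) := by
    refine mul_right_cancel₀ hA0 ?_
    have := hyA (k + 2) (by omega)
    rw [hD] at this
    linear_combination this
  obtain ⟨a₂, rfl⟩ : A ^ (k + 1) ∣ a₁ :=
    (hAB.pow (m := k + 1) (n := k + 4)).dvd_of_dvd_mul_right ⟨y (k + 2), by rw [← hlast]; ring⟩
  have hlast' : y (k + 2) = B ^ (k + 4) * a₂ := by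
    refine mul_right_cancel₀ (pow_ne_zero (k + 1) hA0) ?_
    linear_combination hlast
  have ha₂ : a₂ ≠ 0 := by
    rintro rfl
    exact hD0 (by simp [hD])
  have hAdeg : A.natDegree = 0 := by
    have : a = A ^ (k + 4) * a₂ := by rw [ha₁]; ring
    rw [this, Polynomial.natDegree_mul (pow_ne_zero _ hA0) ha₂, Polynomial.natDegree_pow] at ha
    by_contra hpos
    have := Nat.le_mul_of_pos_right (k + 4) (Nat.pos_of_ne_zero hpos)
    omega
  have hBdeg : B.natDegree = 0 := by
    by_cases hB0 : B = 0
    · simp [hB0]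
    rw [show k + 3 - 1 = k + 2 by omega, hlast',
      Polynomial.natDegree_mul (pow_ne_zero _ hB0) ha₂, Polynomial.natDegree_pow] at hy
    by_contra hpos
    have := Nat.le_mul_of_pos_right (k + 4) (Nat.pos_of_ne_zero hpos)
    omega
  rw [Polynomial.natDegree_eq_zero] at hAdeg hBdeg
  obtain ⟨α, rfl⟩ := hAdeg
  obtain ⟨β, rfl⟩ := hBdeg
  have hα : α ≠ 0 := by
    rintro rfl
    simp at hA0
  refine ⟨β / α, ?_⟩
  rw [hA, hB, mul_left_comm, ← Polynomial.C_mul, div_mul_cancel₀ β hα]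

/-- The `i`-th coordinate of the parametrization `g (1, z, …, zⁿ)`. -/
noncomputable def coordPolynomial {n : ℕ} (g : (Fin (n + 1) → K) →ₗ[K] (Fin (n + 1) → K))
    (i : Fin (n + 1)) : Polynomial K :=
  ∑ j : Fin (n + 1), Polynomial.monomial (j : ℕ) (g (Pi.single j 1) i)

theorem coordPolynomial_coeff {n : ℕ} (g : (Fin (n + 1) → K) →ₗ[K] (Fin (n + 1) → K))
    (i j : Fin (n + 1)) : (coordPolynomial g i).coeff j = g (Pi.single j 1) i := by
  simp [coordPolynomial, Polynomial.coeff_monomial, Fin.val_inj]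

theorem natDegree_coordPolynomial_le {n : ℕ}
    (g : (Fin (n + 1) → K) →ₗ[K] (Fin (n + 1) → K)) (i : Fin (n + 1)) :
    (coordPolynomial g i).natDegree ≤ n :=
  Polynomial.natDegree_sum_le_of_forall_le _ _ fun j _ =>
    (Polynomial.natDegree_monomial_le _).trans (Fin.is_le j)

theorem apply_eq_sum_coeff {n : ℕ} (g : (Fin (n + 1) → K) →ₗ[K] (Fin (n + 1) → K))
    (v : Fin (n + 1) → K) (i : Fin (n + 1)) :
    g v i = ∑ j, v j * (coordPolynomial g i).coeff j := by
  rw [LinearMap.pi_apply_eq_sum_univ g v, Finset.sum_apply]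
  refine Finset.sum_congr rfl fun j _ => ?_
  rw [coordPolynomial_coeff, Pi.smul_apply, smul_eq_mul]
  have : (fun k => if j = k then (1 : K) else 0) = Pi.single j 1 := by
    ext k
    simp [Pi.single_apply, eq_comm]
  rw [this]

theorem exists_evalOption_coordPolynomial {n : ℕ}
    (g : (Fin (n + 1) → K) →ₗ[K] (Fin (n + 1) → K)) {s t : K} (hst : s ≠ 0 ∨ t ≠ 0) :
    ∃ o : Option K, ∃ c : K, c ≠ 0 ∧ ∀ i,
      g (fun j => s ^ (n - (j : ℕ)) * t ^ (j : ℕ)) i = c * evalOption n o (coordPolynomial g i) := by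
  by_cases hs : s = 0
  · subst hs
    refine ⟨none, t ^ n, pow_ne_zero n (by simpa using hst), fun i => ?_⟩
    rw [apply_eq_sum_coeff, Finset.sum_eq_single (Fin.last n)]
    · simp [evalOption]
    · intro j _ hj
      have : n - (j : ℕ) ≠ 0 := by
        have := Fin.val_lt_last hj
        omega
      simp [this]
    · simp
  · refine ⟨some (t / s), s ^ n, pow_ne_zero n hs, fun i => ?_⟩
    rw [apply_eq_sum_coeff, evalOption, Option.elim,
      Polynomial.eval_eq_sum_range' (Nat.lt_succ_of_le (natDegree_coordPolynomial_le g i)),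
      Finset.sum_range, Finset.mul_sum]
    refine Finset.sum_congr rfl fun j _ => ?_
    have : s ^ n = s ^ (n - (j : ℕ)) * s ^ (j : ℕ) := by
      rw [← pow_add]
      congr 1
      have := Fin.is_le j
      omega
    rw [this, div_pow]
    field_simp

theorem exists_weighted_evalOption {n : ℕ} {g : (Fin (n + 1) → K) →ₗ[K] (Fin (n + 1) → K)}
    {C : Set (Projectivization K (Fin (n + 1) → K))}
    (hC : C = {x | ∃ s t : K, (s ≠ 0 ∨ t ≠ 0) ∧
      ∃ h : g (fun j => s ^ (n - (j : ℕ)) * t ^ (j : ℕ)) ≠ 0,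
        x = Projectivization.mk K (g (fun j => s ^ (n - (j : ℕ)) * t ^ (j : ℕ))) h})
    {a : K} (ha : cuspPoint n a ∈ C) :
    ∃ o : Option K, ∃ c : K, c ≠ 0 ∧ ∀ i,
      evalOption n o (coordPolynomial g i) = c * cuspCurve n a i := by
  rw [hC] at ha
  obtain ⟨s, t, hst, h, heq⟩ := ha
  obtain ⟨o, c, hc, hg⟩ := exists_evalOption_coordPolynomial g hst
  obtain ⟨u, hu⟩ := (Projectivization.mk_eq_mk_iff K _ _ _ _).mp heq
  refine ⟨o, c⁻¹ * (u⁻¹ : Kˣ), by simp [hc], fun i => ?_⟩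
  rw [← hu, Pi.smul_apply, hg, Units.smul_def, smul_eq_mul]
  have := u.inv_mul
  field_simp
  linear_combination -evalOption n o (coordPolynomial g i) * this

theorem not_isRNC_of_cuspPoint_mem {n : ℕ} (hn : 3 ≤ n) {A : Finset K} (hA : 2 * n < A.card)
    {C : Set (Projectivization K (Fin (n + 1) → K))} (hAC : ∀ a ∈ A, cuspPoint n a ∈ C) :
    ¬IsRNC n n C := by
  classical
  rintro ⟨g, hg, hC⟩
  choose! o c hc ho using fun a ha => exists_weighted_evalOption hC (hAC a ha)
  have hinj : Set.InjOn o A := by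
    intro a ha b hb hab
    refine cuspPoint_injective (n := n) (by omega) ?_
    refine (Projectivization.mk_eq_mk_iff' K _ _ _ _).mpr ⟨(c a)⁻¹ * c b, ?_⟩
    ext i
    have h1 := ho a ha i
    rw [hab, ho b hb i] at h1
    rw [Pi.smul_apply, smul_eq_mul, mul_assoc, h1, inv_mul_cancel_left₀ (hc a ha)]
  have hcard : n + n < (A.image o).card := by
    rw [Finset.card_image_of_injOn hinj]
    omega
  have hquad : ∀ i j k l : Fin (n + 1),
      (∀ a : K, cuspCurve n a i * cuspCurve n a j = cuspCurve n a k * cuspCurve n a l) →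
      coordPolynomial g i * coordPolynomial g j = coordPolynomial g k * coordPolynomial g l := by
    intro i j k l hrel
    have hdeg := natDegree_coordPolynomial_le g
    rw [← sub_eq_zero]
    refine eq_zero_of_evalOption_eq_zero (m := n + n) ?_ _ hcard ?_
    · exact (Polynomial.natDegree_sub_le_of_le
        (Polynomial.natDegree_mul_le_of_le (hdeg i) (hdeg j))
        (Polynomial.natDegree_mul_le_of_le (hdeg k) (hdeg l))).trans (by simp)
    · simp only [Finset.mem_image, forall_exists_index, and_imp, forall_apply_eq_imp_iff₂]
      intro a ha
      rw [evalOption_sub, evalOption_mul (hdeg i) (hdeg j), evalOption_mul (hdeg k) (hdeg l),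
        ho a ha, ho a ha, ho a ha, ho a ha]
      linear_combination c a ^ 2 * hrel a
  have hsurj : Function.Surjective g := LinearMap.injective_iff_surjective.mp hg
  set y : ℕ → Polynomial K := fun j => if h : j < n then coordPolynomial g (Fin.succ ⟨j, h⟩) else 0
    with hy
  have hyj : ∀ j (h : j < n), y j = coordPolynomial g (Fin.succ ⟨j, h⟩) := fun j h => by simp [hy, h]
  have hdep := eq_zero_or_eq_C_mul_of_cusp_relations hn (a := coordPolynomial g 0) (y := y)
    (natDegree_coordPolynomial_le g 0)
    (by rw [hyj _ (by omega)]; exact natDegree_coordPolynomial_le g _)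
    (by
      rw [hyj 0 (by omega), hyj 2 (by omega)]
      exact hquad _ _ _ _ fun a => by
        simp only [cuspCurve_zero, cuspCurve_succ]
        ring)
    (fun j hj => by
      rw [hyj 0 (by omega), hyj (j + 1) hj, hyj 1 (by omega), hyj j (by omega)]
      exact hquad _ _ _ _ fun a => by
        simp only [cuspCurve_succ]
        ring)
  rw [hyj 0 (by omega), hyj 1 (by omega)] at hdep
  rcases hdep with h | ⟨b, hb⟩
  · obtain ⟨v, hv⟩ := hsurj (Pi.single (Fin.succ ⟨0, by omega⟩) 1)
    have := apply_eq_sum_coeff g v (Fin.succ ⟨0, by omega⟩)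
    rw [hv, h] at this
    simp at this
  · obtain ⟨v, hv⟩ := hsurj (Pi.single (Fin.succ ⟨1, by omega⟩) 1)
    have h1 := apply_eq_sum_coeff g v (Fin.succ ⟨1, by omega⟩)
    have h0 := apply_eq_sum_coeff g v (Fin.succ ⟨0, by omega⟩)
    simp only [hb, Polynomial.coeff_C_mul, mul_left_comm _ b] at h1
    rw [← Finset.mul_sum, ← h0, hv] at h1
    simp at h1

end RationalNormalCurve
section FatPoint

theorem eq_sum_univ_of_isHomogeneous {σ : Type*} [Fintype σ] {f : MvPolynomial σ K} {d : ℕ}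
    (hf : f.IsHomogeneous d) {m : σ →₀ ℕ} (hm : m ∈ f.support) : d = ∑ i, m i :=
  (hf.degree_eq_sum_deg_support hm).trans
    (Finset.sum_subset (Finset.subset_univ _) (by simp))

theorem pointIdeal_cuspPoint_zero_le (n : ℕ) :
    pointIdeal (cuspPoint n (0 : K)) ≤ Ideal.span (X '' Set.range Fin.succ) := by
  obtain ⟨c, hc⟩ := Projectivization.exists_smul_eq_mk_rep K _ (cuspCurve_ne_zero n (0 : K))
  rw [pointIdeal, Ideal.span_le]
  rintro f ⟨b, hb, rfl⟩
  have hb0 : b 0 = 0 := by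
    rw [cuspPoint, ← hc, Fin.sum_univ_succ] at hb
    simpa [Units.smul_def] using hb
  rw [Fin.sum_univ_succ, hb0, map_zero, zero_mul, zero_add]
  exact Submodule.sum_mem _ fun j _ => Ideal.mul_mem_left _ _
    (Ideal.subset_span ⟨j.succ, ⟨j, rfl⟩, rfl⟩)

theorem X_succ_mem_pointIdeal_cuspPoint_zero {n : ℕ} (j : Fin n) :
    X j.succ ∈ pointIdeal (cuspPoint n (0 : K)) :=
  (mem_pointIdeal_mk_iff (cuspCurve_ne_zero n 0) (isHomogeneous_X K j.succ)).mpr (by simp)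

theorem le_sum_succ_of_mem_pow {n k : ℕ} {f : MvPolynomial (Fin (n + 1)) K}
    (hf : f ∈ Ideal.span (X '' Set.range Fin.succ) ^ k) :
    ∀ m ∈ f.support, k ≤ ∑ j : Fin n, m j.succ := by
  classical
  induction k generalizing f with
  | zero => simp
  | succ k ih =>
    rw [pow_succ] at hf
    refine Submodule.mul_induction_on hf (fun g hg h hh m hm => ?_) fun g h hg hh m hm => ?_
    · obtain ⟨a, ha, b, hb, rfl⟩ := Finset.mem_add.mp (support_mul g h hm)
      obtain ⟨_, ⟨j, rfl⟩, hj⟩ := mem_ideal_span_X_image.mp hh b hb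
      have h1 := ih hg a ha
      have h2 := Finset.single_le_sum (f := fun j : Fin n => b j.succ) (fun _ _ => Nat.zero_le _)
        (Finset.mem_univ j)
      simp only [Finsupp.add_apply, Finset.sum_add_distrib]
      omega
    · rcases Finset.mem_union.mp (support_add hm) with hm | hm
      · exact hg m hm
      · exact hh m hm

theorem mem_pointIdeal_cuspPoint_zero_pow_iff {n d : ℕ} {f : MvPolynomial (Fin (n + 1)) K}
    (hf : f.IsHomogeneous d) :
    f ∈ pointIdeal (cuspPoint n (0 : K)) ^ d ↔
      ∃ g : MvPolynomial (Fin n) K, g.IsHomogeneous d ∧ rename Fin.succ g = f := by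
  constructor
  · intro hmem
    have hsum := le_sum_succ_of_mem_pow (Ideal.pow_right_mono (pointIdeal_cuspPoint_zero_le n) d
      hmem)
    obtain ⟨g, rfl⟩ := exists_rename_eq_of_vars_subset_range f Fin.succ (Fin.succ_injective n) (by
      intro i hi
      obtain ⟨m, hm, him⟩ := mem_vars_iff_mem_support i |>.mp hi
      have h1 := hsum m hm
      have h2 := eq_sum_univ_of_isHomogeneous hf hm
      rw [Fin.sum_univ_succ] at h2
      refine Fin.range_succ n ▸ fun h : i = 0 => ?_
      rw [h, Finsupp.mem_support_iff] at him
      omega)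
    exact ⟨g, (IsHomogeneous.rename_isHomogeneous_iff (Fin.succ_injective n)).mp hf, rfl⟩
  · rintro ⟨g, hg, rfl⟩
    rw [g.as_sum, map_sum]
    refine Submodule.sum_mem _ fun m hm => ?_
    have hdeg := eq_sum_univ_of_isHomogeneous hg hm
    rw [monomial_eq, map_mul, Finsupp.prod_fintype _ _ (by simp), map_prod]
    refine Ideal.mul_mem_left _ _ ?_
    rw [hdeg, ← Finset.prod_pow_eq_pow_sum]
    refine Ideal.prod_mem_prod fun j _ => ?_
    rw [map_pow, rename_X]
    exact Ideal.pow_mem_pow (X_succ_mem_pointIdeal_cuspPoint_zero j) _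

/-- Pullback of polynomials to the affine part `(1, z, …, z^{n-1})` of the rational normal
curve. -/
noncomputable def momentPullback (K : Type*) [Field K] (n : ℕ) :
    MvPolynomial (Fin n) K →ₐ[K] Polynomial K :=
  aeval fun j => Polynomial.X ^ (j : ℕ)

theorem natDegree_momentPullback_le {n d : ℕ} {g : MvPolynomial (Fin n) K}
    (hg : g.IsHomogeneous d) : (momentPullback K n g).natDegree ≤ (n - 1) * d := by
  rw [momentPullback, aeval_def, eval₂_eq']
  refine Polynomial.natDegree_sum_le_of_forall_le _ _ fun m hm => ?_
  have hdeg := eq_sum_univ_of_isHomogeneous hg hm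
  refine (Polynomial.natDegree_C_mul_le _ _).trans ((Polynomial.natDegree_prod_le _ _).trans ?_)
  rw [hdeg, Finset.mul_sum]
  refine Finset.sum_le_sum fun j _ => ?_
  rw [← pow_mul, Polynomial.natDegree_X_pow]
  exact Nat.mul_le_mul_right _ (by omega)

theorem exists_momentPullback_eq_X_pow {n : ℕ} (hn : 1 ≤ n) (d e : ℕ) (he : e ≤ (n - 1) * d) :
    ∃ g : MvPolynomial (Fin n) K, g.IsHomogeneous d ∧ momentPullback K n g = Polynomial.X ^ e := by
  induction d generalizing e with
  | zero => exact ⟨1, isHomogeneous_one _ _, by simp_all⟩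
  | succ d ih =>
    rw [mul_add, mul_one] at he
    obtain ⟨g, hg, hge⟩ := ih (e - min e (n - 1)) (by omega)
    refine ⟨g * X ⟨min e (n - 1), by omega⟩, hg.mul (isHomogeneous_X _ _), ?_⟩
    rw [map_mul, hge, momentPullback, aeval_X, ← pow_add]
    congr 1
    simp

theorem map_momentPullback {n : ℕ} (hn : 1 ≤ n) (d : ℕ) :
    (homogeneousSubmodule (Fin n) K d).map (momentPullback K n).toLinearMap =
      Polynomial.degreeLT K ((n - 1) * d + 1) := by
  apply le_antisymm
  · rintro _ ⟨g, hg, rfl⟩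
    rw [Polynomial.mem_degreeLT]
    exact (Polynomial.degree_le_of_natDegree_le (natDegree_momentPullback_le hg)).trans_lt
      (by exact_mod_cast Nat.lt_succ_self _)
  · classical
    rw [Polynomial.degreeLT_eq_span_X_pow, Submodule.span_le]
    intro q hq
    obtain ⟨e, he, rfl⟩ := Finset.mem_image.mp hq
    obtain ⟨g, hg, hge⟩ := exists_momentPullback_eq_X_pow (K := K) hn d e
      (by rw [Finset.mem_range] at he; omega)
    exact ⟨g, hg, hge⟩

theorem finrank_degreeLT (K : Type*) [Field K] (m : ℕ) :
    finrank K (Polynomial.degreeLT K m) = m := by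
  rw [(Polynomial.degreeLTEquiv K m).finrank_eq, finrank_fin_fun]

theorem aeval_cuspCurve_rename_succ {n d : ℕ} {g : MvPolynomial (Fin n) K}
    (hg : g.IsHomogeneous d) (s : K) :
    aeval (cuspCurve n s) (rename Fin.succ g) =
      (momentPullback K n g).eval s * (s ^ 2) ^ d := by
  have h1 : (momentPullback K n g).eval s = aeval (fun j : Fin n => s ^ (j : ℕ)) g := by
    rw [← Polynomial.coe_evalRingHom, ← Polynomial.coe_aeval_eq_evalRingHom]
    change (Polynomial.aeval s) _ = _
    rw [momentPullback, MvPolynomial.comp_aeval_apply]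
    simp
  rw [aeval_rename, h1, ← aeval_mul_right_of_isHomogeneous hg]
  congr 2
  ext j
  simp [pow_add]

theorem hilbDim_fatIdeal_cuspPoint {n d s : ℕ} (hn : 1 ≤ n) (a : Fin s → K)
    (ha : Function.Injective a) (i₀ : Fin s) (h₀ : a i₀ = 0) (hs : (n - 1) * d + 3 = s) :
    hilbDim (fatIdeal (fun i => cuspPoint n (a i)) fun i => if i = i₀ then d else 1) d =
      Nat.choose (n + d - 1) n + ((n - 1) * d + 1) := by
  classical
  have hinj := rename_injective (R := K) _ (Fin.succ_injective n)
  have hdim := hilbDim_add_finrank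
    (fatIdeal (fun i => cuspPoint n (a i)) fun i => if i = i₀ then d else 1) d
    ((homogeneousSubmodule (Fin n) K d ⊓ LinearMap.ker (momentPullback K n).toLinearMap).map
      (rename Fin.succ).toLinearMap) ?_
  · have h1 := finrank_map_add_finrank_inf_ker (momentPullback K n).toLinearMap
      (homogeneousSubmodule (Fin n) K d)
    rw [map_momentPullback hn, finrank_degreeLT, finrank_homogeneousSubmodule_fin] at h1
    rw [← (Submodule.equivMapOfInjective (rename Fin.succ).toLinearMap hinj _).finrank_eq] at hdim
    have h2 : Nat.choose (n + d) d = Nat.choose (n + d - 1) n + Nat.choose (n + d - 1) d := by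
      obtain ⟨n, rfl⟩ : ∃ k, n = k + 1 := ⟨n - 1, by omega⟩
      rw [← Nat.choose_symm_add, show n + 1 + d = n + d + 1 by omega, Nat.choose_succ_succ',
        Nat.choose_symm_add, add_comm, Nat.add_sub_cancel]
    omega
  · intro f
    constructor
    · rintro ⟨g, ⟨hg, hker⟩, rfl⟩
      have hg' : (rename Fin.succ g).IsHomogeneous d := hg.rename_isHomogeneous
      refine ⟨hg', Ideal.mem_iInf.mpr fun i => ?_⟩
      dsimp only
      split_ifs with hi
      · rw [hi, h₀]
        exact (mem_pointIdeal_cuspPoint_zero_pow_iff hg').mpr ⟨g, hg, rfl⟩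
      · rw [pow_one]
        refine (mem_pointIdeal_mk_iff (cuspCurve_ne_zero n (a i)) hg').mpr ?_
        rw [aeval_cuspCurve_rename_succ hg,
          show momentPullback K n g = 0 from hker, Polynomial.eval_zero, zero_mul]
    · rintro ⟨hf, hmem⟩
      have hmem := Ideal.mem_iInf.mp hmem
      have hi₀ := hmem i₀
      dsimp only at hi₀
      rw [if_pos rfl, h₀] at hi₀
      obtain ⟨g, hg, rfl⟩ := (mem_pointIdeal_cuspPoint_zero_pow_iff hf).mp hi₀
      refine ⟨g, ⟨hg, ?_⟩, rfl⟩
      refine Polynomial.eq_zero_of_natDegree_lt_card_of_eval_eq_zero' _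
        ((Finset.univ.erase i₀).image a) ?_ ?_
      · simp only [Finset.mem_image, Finset.mem_erase, Finset.mem_univ, and_true,
          forall_exists_index, and_imp, forall_apply_eq_imp_iff₂]
        intro i hi
        have h := hmem i
        dsimp only at h
        rw [if_neg hi, pow_one] at h
        have h := (mem_pointIdeal_mk_iff (cuspCurve_ne_zero n (a i)) hf).mp h
        rw [aeval_cuspCurve_rename_succ hg] at h
        have hai : a i ≠ 0 := fun h' => hi (ha (h'.trans h₀.symm))
        exact (mul_eq_zero.mp h).resolve_right (pow_ne_zero _ (pow_ne_zero _ hai))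
      · rw [Finset.card_image_of_injective _ ha, Finset.card_erase_of_mem (Finset.mem_univ _),
          Finset.card_univ, Fintype.card_fin]
        have := natDegree_momentPullback_le hg
        change (momentPullback K n g).natDegree < _
        omega

theorem expDeg_ite {n d s : ℕ} (i₀ : Fin s) :
    expDeg n (fun i => if i = i₀ then d else 1) = Nat.choose (n + d - 1) n + (s - 1) := by
  rw [expDeg, ← Finset.add_sum_erase _ _ (Finset.mem_univ i₀), if_pos rfl]
  congr 1
  rw [Finset.sum_congr rfl (g := fun _ => 1)]
  · simp
  · intro i hi
    simp [Finset.ne_of_mem_erase hi]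

end FatPoint

/-- **The cone example.**  Fix `n ≥ 3`, `d ≥ 2` and `s = (n−1)d + 3`.  There exist `s`
distinct points of `ℙⁿ` in uniform position, not contained in any rational normal curve of
degree `n`, such that the quasi-homogeneous scheme `Z = d·p₁ + p₂ + ⋯ + p_s` satisfies
`h¹(I_Z(d)) = 1`, i.e. `dim_K (R/I_Z)_d = C(n+d−1, n) + (s−1) − 1`. -/
theorem cone_example {K : Type*} [Field K] [IsAlgClosed K] {n d : ℕ}
    (hn : 3 ≤ n) (hd : 2 ≤ d) :
    ∃ p : Fin ((n - 1) * d + 3) → Projectivization K (Fin (n + 1) → K),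
      Function.Injective p ∧
      UniformPosition (Set.range p) ∧
      (¬∃ C, IsRNC n n C ∧ Set.range p ⊆ C) ∧
      hilbDim (fatIdeal p fun i => if i = ⟨0, by omega⟩ then d else 1) d =
        expDeg n (fun i : Fin ((n - 1) * d + 3) => if i = ⟨0, by omega⟩ then d else 1) - 1 := by
  have : Infinite K := IsAlgClosed.instInfinite
  obtain ⟨A, hcard, h0, hA⟩ :=
    exists_inGeneralPosition (K := K) n ((n - 1) * d + 3) ((n - 1) * d + 2)
  let i₀ : Fin ((n - 1) * d + 3) := ⟨0, by omega⟩
  obtain ⟨a, ha, harange, ha0⟩ : ∃ a : Fin ((n - 1) * d + 3) → K,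
      Function.Injective a ∧ Set.range a = A ∧ a i₀ = 0 := by
    let e := (A.equivFinOfCardEq hcard).symm
    let e' := (Equiv.swap i₀ (e.symm ⟨0, h0⟩)).trans e
    refine ⟨fun i => e' i, Subtype.val_injective.comp e'.injective, ?_, ?_⟩
    · rw [Set.range_comp' Subtype.val e', e'.range_eq_univ, Set.image_univ, Subtype.range_coe]
    · simp [e']
  have hrange : Set.range (fun i => cuspPoint n (a i)) = cuspPoint n '' (A : Set K) := by
    rw [← harange, ← Set.range_comp]
    rfl
  refine ⟨fun i => cuspPoint n (a i), (cuspPoint_injective (by omega)).comp ha, ?_, ?_, ?_⟩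
  · rw [hrange]
    refine uniformPosition_image_cuspPoint (by omega) ?_
    rw [hcard]
    exact hA
  · rintro ⟨C, hC, hsub⟩
    rw [hrange] at hsub
    refine not_isRNC_of_cuspPoint_mem hn (A := A) ?_ (fun s hs => hsub ⟨s, hs, rfl⟩) hC
    have := Nat.mul_le_mul_left (n - 1) hd
    omega
  · have h1 := hilbDim_fatIdeal_cuspPoint (n := n) (d := d) (by omega) a ha i₀ ha0 rfl
    have h2 := expDeg_ite (n := n) (d := d) i₀
    refine h1.trans ?_
    change _ = expDeg n (fun i => if i = i₀ then d else 1) - 1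
    rw [h2]
    omega
end
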